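/- Let n ≥ 2, q ≥ 2, p = q/(q−1), α ∈ (0,1), Ω ⊂ ℝⁿ bounded open, f ∈ B^α_{p,∞,loc}(Ω), and let u ∈ W^{1,q}_loc(Ω) be a local weak solution of −div((|∇u|−1)_+^{q−1} ∇u/|∇u|) = f. Then H_{q/2}(∇u) ∈ L^r_loc(Ω) for all r ∈ [1, 2n/(n−α−1)), and ∇u ∈ L^s_loc(Ω) for all s ∈ [1, nq/(n−α−1)). -/

import Mathlib

open MeasureTheory Metric
open scoped RealInnerProductSpace ENNReal

/-- `H_a(ξ) = (|ξ|−1)_+^a ξ/|ξ|` (with value `0` at `ξ = 0`). -/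
noncomputable def Hmap (n : ℕ) (a : ℝ) (ξ : EuclideanSpace ℝ (Fin n)) :
    EuclideanSpace ℝ (Fin n) :=
  ((max (‖ξ‖ - 1) 0) ^ a / ‖ξ‖) • ξ

/-- The `s`-th standard unit vector `e_s` of `ℝⁿ`. -/
noncomputable def unitVec (n : ℕ) (s : Fin n) : EuclideanSpace ℝ (Fin n) :=
  EuclideanSpace.single s 1

/-- `u ∈ W^{1,q}_loc(Ω)` with weak gradient `Du`: local `L^q` integrability of `u` and `Du`,
together with the integration-by-parts identity against test functions supported in `Ω`. -/
def MemW1Loc (n : ℕ) (q : ℝ) (Ω : Set (EuclideanSpace ℝ (Fin n)))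
    (u : EuclideanSpace ℝ (Fin n) → ℝ)
    (Du : EuclideanSpace ℝ (Fin n) → EuclideanSpace ℝ (Fin n)) : Prop :=
  (∀ K : Set (EuclideanSpace ℝ (Fin n)), IsCompact K → K ⊆ Ω →
      MemLp u (ENNReal.ofReal q) (volume.restrict K) ∧
      MemLp Du (ENNReal.ofReal q) (volume.restrict K)) ∧
  (∀ φ : EuclideanSpace ℝ (Fin n) → ℝ, ContDiff ℝ 1 φ → HasCompactSupport φ →
      tsupport φ ⊆ Ω →
      ∫ x in Ω, u x • gradient φ x = -∫ x in Ω, φ x • Du x)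

/-- `u` (with gradient `Du`) is a local weak solution of
`−div((|∇u|−1)_+^{q−1} ∇u/|∇u|) = f` in `Ω`:
`∫_Ω ⟨H_{q−1}(∇u), ∇φ⟩ = ∫_Ω f φ` for all test functions `φ` supported in `Ω`. -/
def IsLocalWeakSolution (n : ℕ) (q : ℝ) (Ω : Set (EuclideanSpace ℝ (Fin n)))
    (Du : EuclideanSpace ℝ (Fin n) → EuclideanSpace ℝ (Fin n))
    (f : EuclideanSpace ℝ (Fin n) → ℝ) : Prop :=
  ∀ φ : EuclideanSpace ℝ (Fin n) → ℝ, ContDiff ℝ 1 φ → HasCompactSupport φ →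
    tsupport φ ⊆ Ω →
    ∫ x in Ω, ⟪Hmap n (q - 1) (Du x), gradient φ x⟫ = ∫ x in Ω, f x * φ x

/-- The set of Besov difference quotients of `f` on the set `B`:
`(∫_B |f(x+h e_s) − f(x)|^p / |h|^{αp} dx)^{1/p}` over directions `s` and `h ≠ 0`. -/
def besovSet (n : ℕ) (p α : ℝ) (B : Set (EuclideanSpace ℝ (Fin n)))
    (f : EuclideanSpace ℝ (Fin n) → ℝ) : Set ℝ :=
  {t : ℝ | ∃ (s : Fin n) (h : ℝ), h ≠ 0 ∧
    t = (∫ x in B, |f (x + h • unitVec n s) - f x| ^ p / |h| ^ (α * p)) ^ (1 / p)}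

/-- The Besov norm `‖f‖_{B^α_{p,∞}(B)} = ‖f‖_{L^p(B)} + sup_{h≠0} (...)^{1/p}`. -/
noncomputable def besovNormBall (n : ℕ) (p α : ℝ) (B : Set (EuclideanSpace ℝ (Fin n)))
    (f : EuclideanSpace ℝ (Fin n) → ℝ) : ℝ :=
  (∫ x in B, |f x| ^ p) ^ (1 / p) + sSup (besovSet n p α B f)

/-- `f ∈ B^α_{p,∞,loc}(Ω)`: on every ball compactly contained in `Ω`, `f ∈ L^p` and the
Besov difference quotients are bounded. -/
def MemBesovLoc (n : ℕ) (p α : ℝ) (Ω : Set (EuclideanSpace ℝ (Fin n)))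
    (f : EuclideanSpace ℝ (Fin n) → ℝ) : Prop :=
  ∀ (z : EuclideanSpace ℝ (Fin n)) (r : ℝ), 0 < r → closedBall z r ⊆ Ω →
    IntegrableOn (fun x => |f x| ^ p) (ball z r) volume ∧
    BddAbove (besovSet n p α (ball z r) f)

open MeasureTheory Metric
open scoped RealInnerProductSpace ENNReal

lemma bern {m t s : ℝ} (hm : 0 ≤ m) (hs : 0 ≤ s) (hst : s ≤ t) :
    t * t ^ m - s * s ^ m ≤ (m + 1) * (t ^ m * (t - s)) := by
  rcases eq_or_lt_of_le (hs.trans hst) with h | ht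
  · have : s = 0 := le_antisymm (h ▸ hst) hs
    subst this; rw [← h]; simp
  have hb := one_add_mul_self_le_rpow_one_add (s := s / t - 1) (by have := div_nonneg hs ht.le; linarith)
    (p := m + 1) (by linarith)
  have e1 : (1 + (s / t - 1)) ^ (m + 1) = (s * s ^ m) / (t * t ^ m) := by
    rw [show 1 + (s / t - 1) = s / t by ring, Real.div_rpow hs ht.le, Real.rpow_add_one ht.ne',
      Real.rpow_add_one' hs (by linarith)]
    ring
  rw [e1, le_div_iff₀ (by positivity)] at hb
  have e2 : (1 + (m + 1) * (s / t - 1)) * (t * t ^ m) = t * t ^ m + (m+1) * (s - t) * t ^ m := by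
    field_simp
  rw [e2] at hb
  nlinarith [hb]

/-- scalar inequalities -/
lemma scal1 {m t s : ℝ} (hm : 0 ≤ m) (hs : 0 ≤ s) (ht : 0 ≤ t) :
    (t * t ^ m - s * s ^ m) ^ 2 ≤ (m + 1) * ((t - s) * (t * (t ^ m) ^ 2 - s * (s ^ m) ^ 2)) := by
  wlog hst : s ≤ t generalizing s t
  · have := this ht hs (le_of_not_ge hst); nlinarith
  have h1 := bern hm hs hst
  have hS : 0 ≤ s ^ m := by positivity
  have hT : s ^ m ≤ t ^ m := Real.rpow_le_rpow hs hst hm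
  generalize t ^ m = T at *
  generalize s ^ m = S at *
  have h2 : 0 ≤ t * T - s * S := by nlinarith [mul_nonneg hs hS]
  have h3 : T * (t * T - s * S) ≤ t * T ^ 2 - s * S ^ 2 := by
    have := mul_nonneg (mul_nonneg hs hS) (sub_nonneg.2 hT); nlinarith
  calc (t * T - s * S) ^ 2 ≤ ((m + 1) * (T * (t - s))) * (t * T - s * S) := by
        rw [sq]; exact mul_le_mul_of_nonneg_right h1 h2
    _ = (m + 1) * ((t - s) * (T * (t * T - s * S))) := by ring
    _ ≤ _ := by gcongr

lemma scal2 {m t s : ℝ} (hm : 0 ≤ m) (hs : 0 ≤ s) (ht : 0 ≤ t) :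
    (t * (t ^ m) ^ 2 - s * (s ^ m) ^ 2) ^ 2 ≤
      4 * ((t ^ m + s ^ m) ^ 2 * (t * t ^ m - s * s ^ m) ^ 2) := by
  wlog hst : s ≤ t generalizing s t
  · have := this ht hs (le_of_not_ge hst); nlinarith
  have hS : 0 ≤ s ^ m := by positivity
  have hT : s ^ m ≤ t ^ m := Real.rpow_le_rpow hs hst hm
  generalize t ^ m = T at *
  generalize s ^ m = S at *
  have h2 : 0 ≤ t * T - s * S := by nlinarith [mul_nonneg hs hS]
  have h3 : t * T ^ 2 - s * S ^ 2 ≤ 2 * (T * (t * T - s * S)) := by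
    nlinarith [mul_nonneg hs (sq_nonneg (T - S)), mul_nonneg (sub_nonneg.2 hst) (sq_nonneg T)]
  have h3' : t * T ^ 2 - s * S ^ 2 ≤ 2 * ((T + S) * (t * T - s * S)) := by
    nlinarith [mul_nonneg hS h2]
  have h4 : 0 ≤ t * T ^ 2 - s * S ^ 2 := by
    have := mul_nonneg (mul_nonneg hs hS) (sub_nonneg.2 hT)
    nlinarith [mul_nonneg (hS.trans hT) h2]
  calc _ ≤ (2 * ((T + S) * (t * T - s * S))) ^ 2 := by gcongr
    _ = _ := by ring

lemma Hmap_norm {n : ℕ} (k : ℝ) (hk : 0 < k) (ξ : EuclideanSpace ℝ (Fin n)) :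
    ‖Hmap n k ξ‖ = (max (‖ξ‖ - 1) 0) ^ k := by
  rw [Hmap, norm_smul, Real.norm_of_nonneg (by positivity)]
  rcases eq_or_ne ξ 0 with h | h
  · subst h; simp [Real.zero_rpow hk.ne']
  · have := norm_pos_iff.2 h
    field_simp

lemma Hmap_measurable {n : ℕ} (k : ℝ) : Measurable (Hmap n k) := by
  unfold Hmap; fun_prop

lemma rpw_q2 {q t : ℝ} (hq : 2 ≤ q) (ht : 0 ≤ t) : t ^ (q / 2) = t * t ^ (q / 2 - 1) := by
  conv_lhs => rw [show q / 2 = (q / 2 - 1) + 1 by ring]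
  rw [Real.rpow_add_one' ht (by linarith), mul_comm]

lemma rpw_q1 {q t : ℝ} (hq : 2 ≤ q) (ht : 0 ≤ t) :
    t ^ (q - 1) = t * (t ^ (q / 2 - 1)) ^ 2 := by
  conv_lhs => rw [show q - 1 = (q / 2 - 1) + (q / 2 - 1) + 1 by ring]
  rw [Real.rpow_add_one' ht (by linarith), Real.rpow_add_of_nonneg ht (by linarith) (by linarith)]
  ring

lemma unit_sub_sq {E : Type*} [NormedAddCommGroup E] [InnerProductSpace ℝ E] (x y : ℝ) (e e' : E)
    (he : ‖e‖ = 1) (he' : ‖e'‖ = 1) :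
    ‖x • e - y • e'‖ ^ 2 = (x - y) ^ 2 + 2 * (x * y) * (1 - ⟪e, e'⟫) := by
  rw [norm_sub_sq_real, norm_smul, norm_smul, he, he', inner_smul_left, inner_smul_right]
  simp; ring

lemma Hmap_dir {n : ℕ} (hn : 2 ≤ n) (ξ : EuclideanSpace ℝ (Fin n)) :
    ∃ e : EuclideanSpace ℝ (Fin n), ‖e‖ = 1 ∧ ξ = ‖ξ‖ • e ∧
      ∀ k : ℝ, 0 < k → Hmap n k ξ = (max (‖ξ‖ - 1) 0) ^ k • e := by
  rcases eq_or_ne ξ 0 with h | h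
  · refine ⟨EuclideanSpace.single ⟨0, by omega⟩ 1, by simp, by simp [h], fun k hk => ?_⟩
    subst h; simp [Hmap, Real.zero_rpow hk.ne']
  · have := norm_pos_iff.2 h
    refine ⟨‖ξ‖⁻¹ • ξ, by simp [norm_smul, this.ne'], by rw [smul_smul]; simp [this.ne'], fun k hk => ?_⟩
    rw [Hmap, smul_smul, div_eq_mul_inv]

lemma Hineq {n : ℕ} (hn : 2 ≤ n) {q : ℝ} (hq : 2 ≤ q) (ξ ζ : EuclideanSpace ℝ (Fin n)) :
    2 / q * ‖Hmap n (q / 2) ξ - Hmap n (q / 2) ζ‖ ^ 2 ≤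
      ⟪Hmap n (q - 1) ξ - Hmap n (q - 1) ζ, ξ - ζ⟫ ∧
    ‖Hmap n (q - 1) ξ - Hmap n (q - 1) ζ‖ ^ 2 ≤
      16 * ((‖ξ‖ + ‖ζ‖) ^ (q - 2)) *
        ‖Hmap n (q / 2) ξ - Hmap n (q / 2) ζ‖ ^ 2 := by
  obtain ⟨e, he, hξ, hH⟩ := Hmap_dir hn ξ
  obtain ⟨e', he', hζ, hH'⟩ := Hmap_dir hn ζ
  rw [hH _ (by linarith), hH _ (by linarith), hH' _ (by linarith), hH' _ (by linarith)]
  have ha0 : 0 ≤ ‖ξ‖ := norm_nonneg _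
  have hb0 : 0 ≤ ‖ζ‖ := norm_nonneg _
  have hinn : ⟪(max (‖ξ‖ - 1) 0) ^ (q - 1) • e - (max (‖ζ‖ - 1) 0) ^ (q - 1) • e', ξ - ζ⟫ =
      ((max (‖ξ‖ - 1) 0) ^ (q - 1) - (max (‖ζ‖ - 1) 0) ^ (q - 1)) * (‖ξ‖ - ‖ζ‖) +
      (1 - ⟪e, e'⟫) * ((max (‖ξ‖ - 1) 0) ^ (q - 1) * ‖ζ‖ + (max (‖ζ‖ - 1) 0) ^ (q - 1) * ‖ξ‖) := by
    conv_lhs => rw [hξ, hζ]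
    simp only [norm_smul, he, he', norm_norm, mul_one]
    simp only [inner_sub_left, inner_sub_right, inner_smul_left, inner_smul_right,
      real_inner_self_eq_norm_sq, he, he', real_inner_comm e e']
    simp
    ring
  rw [hinn, unit_sub_sq _ _ _ _ he he', unit_sub_sq _ _ _ _ he he']
  have hc : ⟪e, e'⟫ ≤ 1 := by
    have := real_inner_le_norm e e'; rw [he, he'] at this; linarith
  generalize ⟪e, e'⟫ = c at hc
  clear hinn hH hH' hξ hζ
  generalize ‖ξ‖ = a at *
  generalize ‖ζ‖ = b at *
  have hta : max (a - 1) 0 ≤ a := max_le (by linarith) ha0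
  have hsb : max (b - 1) 0 ≤ b := max_le (by linarith) hb0
  have hts : (a ≤ b → max (a - 1) 0 ≤ max (b - 1) 0 ∧ max (b - 1) 0 - max (a - 1) 0 ≤ b - a) ∧
      (b ≤ a → max (b - 1) 0 ≤ max (a - 1) 0 ∧ max (a - 1) 0 - max (b - 1) 0 ≤ a - b) := by
    constructor <;> intro h <;> constructor <;>
      rcases max_cases (a - 1) 0 with h1 | h1 <;> rcases max_cases (b - 1) 0 with h2 | h2 <;> linarith
  have ht : 0 ≤ max (a - 1) 0 := le_max_right _ _
  have hs : 0 ≤ max (b - 1) 0 := le_max_right _ _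
  generalize max (a - 1) 0 = t at *
  generalize max (b - 1) 0 = s at *
  have hm : 0 ≤ q / 2 - 1 := by linarith
  have hTM : t ^ (q / 2 - 1) ≤ (a + b) ^ (q / 2 - 1) := Real.rpow_le_rpow ht (by linarith) hm
  have hSM : s ^ (q / 2 - 1) ≤ (a + b) ^ (q / 2 - 1) := Real.rpow_le_rpow hs (by linarith) hm
  have hMM : (a + b) ^ (q - 2) = ((a + b) ^ (q / 2 - 1)) ^ 2 := by
    rw [sq, ← Real.rpow_add_of_nonneg (by linarith) hm hm]; ring_nf
  have hmono : ∀ x y : ℝ, 0 ≤ x → x ≤ y → x ^ (q / 2 - 1) ≤ y ^ (q / 2 - 1) :=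
    fun x y hx hxy => Real.rpow_le_rpow hx hxy hm
  have h1 := scal1 hm hs ht
  have h2 := scal2 hm hs ht
  have hmt := hmono t s ht
  have hms := hmono s t hs
  rw [rpw_q2 hq ht, rpw_q2 hq hs, rpw_q1 hq ht, rpw_q1 hq hs, hMM]
  have hT : 0 ≤ t ^ (q / 2 - 1) := by positivity
  have hS : 0 ≤ s ^ (q / 2 - 1) := by positivity
  generalize t ^ (q / 2 - 1) = T at *
  generalize s ^ (q / 2 - 1) = S at *
  generalize (a + b) ^ (q / 2 - 1) = M at *
  have hM : 0 ≤ M := hT.trans hTM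
  clear hMM hmono
  constructor
  · have k1 : (t - s) * (t * T ^ 2 - s * S ^ 2) ≤ (t * T ^ 2 - s * S ^ 2) * (a - b) := by
      rcases le_total a b with h | h
      · obtain ⟨x1, x2⟩ := hts.1 h
        have x3 : t * T ^ 2 ≤ s * S ^ 2 := by
          have := hmt x1
          gcongr
        nlinarith
      · obtain ⟨x1, x2⟩ := hts.2 h
        have x3 : s * S ^ 2 ≤ t * T ^ 2 := by
          have := hms x1
          gcongr
        nlinarith
    have k2 : 2 * (t * T * (s * S)) ≤ t * T ^ 2 * b + s * S ^ 2 * a := by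
      have y1 : t * T ^ 2 * s ≤ t * T ^ 2 * b := by gcongr
      have y2 : s * S ^ 2 * t ≤ s * S ^ 2 * a := by gcongr
      nlinarith [mul_nonneg (mul_nonneg ht hs) (sq_nonneg (T - S))]
    have hq' : 2 / q ≤ 1 := by rw [div_le_one (by linarith)]; exact hq
    have k3 := mul_le_mul_of_nonneg_left k2 (sub_nonneg.2 hc)
    have k4 : 0 ≤ (1 - c) * (2 * (t * T * (s * S))) := mul_nonneg (sub_nonneg.2 hc) (by positivity)
    have k5 : 2 / q * (t * T - s * S) ^ 2 ≤ (t - s) * (t * T ^ 2 - s * S ^ 2) := by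
      rw [div_mul_eq_mul_div, div_le_iff₀ (by linarith)]
      nlinarith
    nlinarith
  · have k1 : (T + S) ^ 2 ≤ (2 * M) ^ 2 := by gcongr; linarith
    have k2 : T * S ≤ M ^ 2 := by rw [sq]; gcongr
    have k3 : t * T ^ 2 * (s * S ^ 2) ≤ M ^ 2 * (t * T * (s * S)) := by
      have : 0 ≤ t * T * (s * S) := by positivity
      nlinarith
    have k4 : 0 ≤ (1 - c) * (t * T * (s * S)) := mul_nonneg (sub_nonneg.2 hc) (by positivity)
    have k5 := mul_le_mul_of_nonneg_left k3 (sub_nonneg.2 hc)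
    have k6 := mul_le_mul_of_nonneg_right k1 (sq_nonneg (t * T - s * S))
    nlinarith [mul_nonneg (sq_nonneg M) k4]

open MeasureTheory Metric
open scoped RealInnerProductSpace ENNReal

lemma eLpNorm_ofReal_eq {α W : Type*} [MeasurableSpace α] [NormedAddCommGroup W] (μ : Measure α)
    (F : α → W) {q : ℝ} (hq : 0 < q) :
    eLpNorm F (ENNReal.ofReal q) μ = (∫⁻ x, ‖F x‖ₑ ^ q ∂μ) ^ (1 / q) := by
  rw [eLpNorm_eq_lintegral_rpow_enorm_toReal (by simpa using hq) ENNReal.ofReal_ne_top,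
    ENNReal.toReal_ofReal hq.le]

lemma eLpNorm_ofReal_rpow {α W : Type*} [MeasurableSpace α] [NormedAddCommGroup W] (μ : Measure α)
    (F : α → W) {q : ℝ} (hq : 0 < q) :
    eLpNorm F (ENNReal.ofReal q) μ ^ q = ∫⁻ x, ‖F x‖ₑ ^ q ∂μ := by
  rw [eLpNorm_ofReal_eq μ F hq, ← ENNReal.rpow_mul, one_div_mul_cancel hq.ne', ENNReal.rpow_one]

lemma memLp_ofReal_iff {α W : Type*} [MeasurableSpace α] [NormedAddCommGroup W] (μ : Measure α)
    (F : α → W) {q : ℝ} (hq : 0 < q) (hF : AEStronglyMeasurable F μ) :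
    MemLp F (ENNReal.ofReal q) μ ↔ ∫⁻ x, ‖F x‖ₑ ^ q ∂μ < ∞ := by
  rw [← eLpNorm_ofReal_rpow μ F hq, MemLp]
  simp [hF, ENNReal.rpow_lt_top_iff_of_pos hq]

lemma jensen_rpow {α : Type*} [MeasurableSpace α] (ν : Measure α) [IsProbabilityMeasure ν]
    {F : α → ℝ≥0∞} (hF : AEMeasurable F ν) {q : ℝ} (hq : 1 ≤ q) :
    (∫⁻ x, F x ∂ν) ^ q ≤ ∫⁻ x, F x ^ q ∂ν := by
  have h := eLpNorm'_le_eLpNorm'_of_exponent_le (f := F) one_pos hq ν hF.aestronglyMeasurable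
  have hq0 : 0 < q := by linarith
  simp only [eLpNorm'] at h
  have h2 := ENNReal.rpow_le_rpow h hq0.le
  rw [← ENNReal.rpow_mul, ← ENNReal.rpow_mul, one_div_mul_cancel hq0.ne'] at h2
  simpa using h2

lemma translation_cont {n : ℕ} {W : Type*} [NormedAddCommGroup W]
    {F : EuclideanSpace ℝ (Fin n) → W} {q : ℝ} (hq : 1 ≤ q)
    (hF : MemLp F (ENNReal.ofReal q) volume) {ε : ℝ≥0∞} (hε : 0 < ε) :
    ∃ δ > 0, ∀ y : EuclideanSpace ℝ (Fin n), ‖y‖ < δ →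
      eLpNorm (fun x => F (x - y) - F x) (ENNReal.ofReal q) volume < ε := by
  haveI : Fact ((1 : ℝ≥0∞) ≤ ENNReal.ofReal q) := ⟨by simpa using hq⟩
  let g : EuclideanSpace ℝ (Fin n) → C(EuclideanSpace ℝ (Fin n), EuclideanSpace ℝ (Fin n)) :=
    (ContinuousMap.mk (fun a : EuclideanSpace ℝ (Fin n) × EuclideanSpace ℝ (Fin n) => a.2 - a.1)
      (by fun_prop)).curry
  have hg : Continuous g := ContinuousMap.continuous _
  have hgm : ∀ y, MeasurePreserving (g y) volume volume := fun y =>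
    measurePreserving_sub_right volume y
  have hc := Continuous.compMeasurePreservingLp (continuous_const (y := hF.toLp F)) hg hgm
    ENNReal.ofReal_ne_top
  have h0 : Filter.Tendsto (fun y => ‖Lp.compMeasurePreserving (g y) (hgm y) (hF.toLp F) -
      hF.toLp F‖ₑ) (nhds 0) (nhds 0) := by
    have h1 := (hc.sub (continuous_const (y := hF.toLp F))).enorm.tendsto 0
    have h2 : Lp.compMeasurePreserving (g 0) (hgm 0) (hF.toLp F) = hF.toLp F := by
      rw [Lp.toLp_compMeasurePreserving]
      congr 1
      ext x
      simp [g]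
    simpa [h2] using h1
  have := (ENNReal.tendsto_nhds_zero.1 h0) (min (ε / 2) 1) (by
    simp [hε.ne'])
  obtain ⟨δ, hδ, hb⟩ := Metric.eventually_nhds_iff.1 this
  refine ⟨δ, hδ, fun y hy => ?_⟩
  have hy' := hb (y := y) (by simpa using hy)
  rw [Lp.toLp_compMeasurePreserving, ← MemLp.toLp_sub, Lp.enorm_toLp] at hy'
  have e : (fun x => F (x - y) - F x) = F ∘ (g y) - F := by ext x; simp [g]
  rw [e]
  refine hy'.trans_lt ?_
  by_cases hε' : ε = ∞
  · subst hε'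
    exact (min_le_right _ _).trans_lt (by simp)
  · exact (min_le_left _ _).trans_lt (ENNReal.half_lt_self hε.ne' hε')

open scoped Convolution in
lemma mollify_conv {n : ℕ} {W : Type*} [NormedAddCommGroup W] [NormedSpace ℝ W] [CompleteSpace W]
    [MeasurableSpace W] [BorelSpace W] [SecondCountableTopology W]
    {F : EuclideanSpace ℝ (Fin n) → W} {q : ℝ} (hq : 1 ≤ q) (hFm : Measurable F)
    (hF : MemLp F (ENNReal.ofReal q) volume) {ε : ℝ≥0∞} (hε : 0 < ε) :
    ∃ δ > 0, ∀ ρ : ContDiffBump (0 : EuclideanSpace ℝ (Fin n)), ρ.rOut < δ →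
      eLpNorm (fun x => (ρ.normed volume ⋆[ContinuousLinearMap.lsmul ℝ ℝ, volume] F) x - F x)
        (ENNReal.ofReal q) volume ≤ ε := by
  obtain ⟨δ, hδ, H⟩ := translation_cont hq hF hε
  refine ⟨δ, hδ, fun ρ hρ => ?_⟩
  have hq0 : 0 < q := by linarith
  set ν : Measure (EuclideanSpace ℝ (Fin n)) :=
    volume.withDensity (fun y => ENNReal.ofReal (ρ.normed volume y)) with hν
  have hρc : Continuous (ρ.normed volume) := ρ.continuous_normed
  have hden : Measurable (fun y => ENNReal.ofReal (ρ.normed volume y)) := by fun_prop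
  haveI : IsProbabilityMeasure ν := by
    constructor
    rw [hν, withDensity_apply _ MeasurableSet.univ, Measure.restrict_univ,
      ← ofReal_integral_eq_lintegral_ofReal ρ.integrable_normed
        (Filter.Eventually.of_forall fun x => ρ.nonneg_normed x), ρ.integral_normed]
    simp
  have hloc : LocallyIntegrable F volume :=
    hF.locallyIntegrable (by simpa using hq)
  have hpt : ∀ x, ‖(ρ.normed volume ⋆[ContinuousLinearMap.lsmul ℝ ℝ, volume] F) x - F x‖ₑ ≤
      ∫⁻ y, ‖F (x - y) - F x‖ₑ ∂ν := by
    intro x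
    have e1 : F x = ∫ y, ρ.normed volume y • F x := (ρ.integral_normed_smul (μ := volume) (F x)).symm
    have hci := (ρ.hasCompactSupport_normed (μ := volume)).convolutionExists_left
      (ContinuousLinearMap.lsmul ℝ ℝ) hρc hloc x
    have e2 : (ρ.normed volume ⋆[ContinuousLinearMap.lsmul ℝ ℝ, volume] F) x - F x =
        ∫ y, ρ.normed volume y • (F (x - y) - F x) := by
      conv_lhs => rw [e1]
      rw [convolution_def, ← integral_sub]
      · simp [smul_sub]
      · exact hci
      · exact ρ.integrable_normed.smul_const _
    rw [e2]
    refine (enorm_integral_le_lintegral_enorm _).trans_eq ?_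
    rw [hν, lintegral_withDensity_eq_lintegral_mul _ hden (by fun_prop)]
    refine lintegral_congr fun y => ?_
    simp only [Pi.mul_apply, enorm_smul]
    rw [Real.enorm_of_nonneg (ρ.nonneg_normed y)]
  have hmain : ∫⁻ x, ‖(ρ.normed volume ⋆[ContinuousLinearMap.lsmul ℝ ℝ, volume] F) x - F x‖ₑ ^ q ≤
      ε ^ q := by
    calc _ ≤ ∫⁻ x, ∫⁻ y, ‖F (x - y) - F x‖ₑ ^ q ∂ν := by
          refine lintegral_mono fun x => ?_
          refine (ENNReal.rpow_le_rpow (hpt x) hq0.le).trans ?_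
          exact jensen_rpow ν (by fun_prop) hq
      _ = ∫⁻ y, ∫⁻ x, ‖F (x - y) - F x‖ₑ ^ q ∂volume ∂ν := by
          apply lintegral_lintegral_swap
          fun_prop
      _ = ∫⁻ y, ENNReal.ofReal (ρ.normed volume y) * ∫⁻ x, ‖F (x - y) - F x‖ₑ ^ q := by
          rw [hν, lintegral_withDensity_eq_lintegral_mul _ hden]
          · rfl
          · apply Measurable.lintegral_prod_right
            fun_prop
      _ ≤ ∫⁻ y, ENNReal.ofReal (ρ.normed volume y) * ε ^ q := by
          refine lintegral_mono fun y => ?_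
          by_cases hy : ‖y‖ < δ
          · gcongr
            rw [← eLpNorm_ofReal_rpow _ (fun x => F (x - y) - F x) hq0]
            exact ENNReal.rpow_le_rpow (H y hy).le hq0.le
          · have : ρ.normed volume y = 0 := by
              rw [← Function.notMem_support, ρ.support_normed_eq]
              simp; linarith
            simp [this]
      _ = ε ^ q := by
          rw [lintegral_mul_const _ hden]
          have : ∫⁻ y, ENNReal.ofReal (ρ.normed volume y) = ν Set.univ := by
            rw [hν, withDensity_apply _ MeasurableSet.univ, Measure.restrict_univ]
          rw [this, measure_univ, one_mul]
  rw [eLpNorm_ofReal_eq _ _ hq0]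
  calc _ ≤ (ε ^ q) ^ (1 / q) := ENNReal.rpow_le_rpow hmain (by positivity)
    _ = ε := by rw [← ENNReal.rpow_mul, mul_one_div_cancel hq0.ne', ENNReal.rpow_one]

open MeasureTheory Metric
open scoped RealInnerProductSpace ENNReal Convolution
set_option linter.unusedVariables false

lemma inner_gradient_eq {n : ℕ} {φ : EuclideanSpace ℝ (Fin n) → ℝ} {x w : EuclideanSpace ℝ (Fin n)} :
    ⟪gradient φ x, w⟫ = fderiv ℝ φ x w := by
  simp [gradient]

lemma gradient_moll {n : ℕ} {q : ℝ} (hq : 1 ≤ q) {Ω : Set (EuclideanSpace ℝ (Fin n))}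
    {u : EuclideanSpace ℝ (Fin n) → ℝ}
    {Du : EuclideanSpace ℝ (Fin n) → EuclideanSpace ℝ (Fin n)}
    (hu : MemW1Loc n q Ω u Du) (K' : Set (EuclideanSpace ℝ (Fin n))) (hK'c : IsCompact K')
    (hK' : K' ⊆ Ω) (hΩ : IsOpen Ω) (ρ : ContDiffBump (0 : EuclideanSpace ℝ (Fin n)))
    (x : EuclideanSpace ℝ (Fin n)) (hx : closedBall x ρ.rOut ⊆ K') 
    (hloc : LocallyIntegrable (K'.indicator u) volume) 
    (hlocD : LocallyIntegrable (K'.indicator Du) volume) :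
    gradient (ρ.normed volume ⋆[ContinuousLinearMap.lsmul ℝ ℝ, volume] (K'.indicator u)) x =
      (ρ.normed volume ⋆[ContinuousLinearMap.lsmul ℝ ℝ, volume] (K'.indicator Du)) x := by
  have hcs := ρ.hasCompactSupport_normed (μ := volume)
  have hcd : ContDiff ℝ 1 (ρ.normed volume) := ρ.contDiff_normed
  have hd := hcs.hasFDerivAt_convolution_left (ContinuousLinearMap.lsmul ℝ ℝ) hcd hloc x
  -- the test function
  set φ : EuclideanSpace ℝ (Fin n) → ℝ := fun y => ρ.normed volume (x - y) with hφ
  have hφd : ContDiff ℝ 1 φ := hcd.comp (contDiff_const.sub contDiff_id)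
  have hφsupp : Function.support φ ⊆ ball x ρ.rOut := by
    intro y hy
    have : x - y ∈ Function.support (ρ.normed volume) := hy
    rw [ρ.support_normed_eq] at this
    rw [mem_ball, dist_eq_norm, norm_sub_rev]; simpa using this
  have hφts : tsupport φ ⊆ closedBall x ρ.rOut :=
    closure_minimal (hφsupp.trans ball_subset_closedBall) isClosed_closedBall
  have hφc : HasCompactSupport φ := HasCompactSupport.of_support_subset_isCompact
    (isCompact_closedBall x ρ.rOut) (hφsupp.trans ball_subset_closedBall)
  have hibp := hu.2 φ hφd hφc (hφts.trans (hx.trans hK'))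
  have hfd : ∀ y w, fderiv ℝ φ y w = - fderiv ℝ (ρ.normed volume) (x - y) w := by
    intro y w
    have h1 : HasFDerivAt (ρ.normed volume) (fderiv ℝ (ρ.normed volume) (x - y)) (x - y) :=
      (hcd.differentiable (by norm_num) _).hasFDerivAt
    have h2 : HasFDerivAt (fun y : EuclideanSpace ℝ (Fin n) => x - y)
      (-ContinuousLinearMap.id ℝ _) y := (hasFDerivAt_id y).const_sub x
    have := (h1.comp y h2).fderiv
    rw [show φ = ρ.normed volume ∘ fun y => x - y from rfl, this]
    simp
  have hgz : ∀ y, y ∉ K' → gradient φ y = 0 := by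
    intro y hy
    have : y ∉ tsupport φ := fun h => hy (hx (hφts h))
    have h0 : fderiv ℝ φ y = 0 := by
      have := mt (fun h => support_fderiv_subset ℝ h) this
      simpa using this
    simp [gradient, h0]
  have hφz : ∀ y, y ∉ K' → φ y = 0 := by
    intro y hy
    by_contra h
    exact hy (hx (ball_subset_closedBall (hφsupp h)))
  have e1 : ∫ y in Ω, u y • gradient φ y = ∫ y, K'.indicator u y • gradient φ y := by
    rw [setIntegral_eq_integral_of_forall_compl_eq_zero]
    · congr 1; ext1 y
      by_cases hy : y ∈ K'
      · simp [hy]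
      · simp [hy, hgz y hy]
    · intro y hy
      rw [hgz y (fun h => hy (hK' h)), smul_zero]
  have e2 : ∫ y in Ω, φ y • Du y = ∫ y, φ y • K'.indicator Du y := by
    rw [setIntegral_eq_integral_of_forall_compl_eq_zero]
    · congr 1; ext1 y
      by_cases hy : y ∈ K'
      · simp [hy]
      · simp [hy, hφz y hy]
    · intro y hy
      rw [hφz y (fun h => hy (hK' h)), zero_smul]
  have e3 : (ρ.normed volume ⋆[ContinuousLinearMap.lsmul ℝ ℝ, volume] (K'.indicator Du)) x =
      ∫ y, φ y • K'.indicator Du y := by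
    rw [convolution_eq_swap]
    simp [hφ]
  rw [e1, e2, ← e3] at hibp
  refine ext_inner_right ℝ fun w => ?_
  rw [inner_gradient_eq, hd.fderiv, convolution_eq_swap]
  have hgc : Continuous (gradient φ) := by
    unfold gradient
    exact (LinearIsometryEquiv.continuous _).comp (hφd.continuous_fderiv (by norm_num))
  have hgcs : HasCompactSupport (gradient φ) := by
    refine HasCompactSupport.of_support_subset_isCompact hK'c fun y hy => ?_
    by_contra h
    exact hy (hgz y h)
  have hi1 : Integrable (fun y => K'.indicator u y • gradient φ y) volume := by
    exact hloc.integrable_smul_right_of_hasCompactSupport hgc hgcs 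
  have hi2 : Integrable (fun t => ((ContinuousLinearMap.lsmul ℝ ℝ).precompL
      (EuclideanSpace ℝ (Fin n))) (fderiv ℝ (ρ.normed volume) (x - t)) (K'.indicator u t)) volume := by
    have := ((hcs.fderiv (𝕜 := ℝ)).convolutionExists_left ((ContinuousLinearMap.lsmul ℝ ℝ).precompL
      (EuclideanSpace ℝ (Fin n))) (hcd.continuous_fderiv (by norm_num)) hloc x)
    exact this.integrable_swap
  rw [ContinuousLinearMap.integral_apply hi2]
  have : (ρ.normed volume ⋆[ContinuousLinearMap.lsmul ℝ ℝ, volume] (K'.indicator Du)) x =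
    - ∫ y, K'.indicator u y • gradient φ y := by rw [hibp, neg_neg]
  rw [this, inner_neg_left, real_inner_comm, ← integral_inner hi1, ← integral_neg]
  congr 1; ext1 y
  rw [inner_smul_right, real_inner_comm, inner_gradient_eq, hfd]
  simp
  ring

lemma approx_W1 {n : ℕ} {q : ℝ} (hq : 1 ≤ q) {Ω : Set (EuclideanSpace ℝ (Fin n))}
    {u : EuclideanSpace ℝ (Fin n) → ℝ}
    {Du : EuclideanSpace ℝ (Fin n) → EuclideanSpace ℝ (Fin n)} (hum : Measurable u)
    (hDum : Measurable Du)
    (hu : MemW1Loc n q Ω u Du) (hΩ : IsOpen Ω) {K : Set (EuclideanSpace ℝ (Fin n))}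
    (hK : IsCompact K) (hKΩ : K ⊆ Ω) :
    ∃ v : ℕ → EuclideanSpace ℝ (Fin n) → ℝ, (∀ k, ContDiff ℝ 1 (v k)) ∧
      Filter.Tendsto (fun k => eLpNorm (fun x => v k x - u x) (ENNReal.ofReal q)
        (volume.restrict K)) Filter.atTop (nhds 0) ∧
      Filter.Tendsto (fun k => eLpNorm (fun x => gradient (v k) x - Du x) (ENNReal.ofReal q)
        (volume.restrict K)) Filter.atTop (nhds 0) := by
  suffices h : ∀ ε : ℝ≥0∞, 0 < ε → ∃ v : EuclideanSpace ℝ (Fin n) → ℝ, ContDiff ℝ 1 v ∧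
      eLpNorm (fun x => v x - u x) (ENNReal.ofReal q) (volume.restrict K) ≤ ε ∧
      eLpNorm (fun x => gradient v x - Du x) (ENNReal.ofReal q) (volume.restrict K) ≤ ε by
    choose v hv using fun k : ℕ => h ((k : ℝ≥0∞)⁻¹) (by simp)
    refine ⟨v, fun k => (hv k).1, ?_, ?_⟩
    · exact tendsto_of_tendsto_of_tendsto_of_le_of_le tendsto_const_nhds
        ENNReal.tendsto_inv_nat_nhds_zero (fun k => zero_le) (fun k => (hv k).2.1)
    · exact tendsto_of_tendsto_of_tendsto_of_le_of_le tendsto_const_nhds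
        ENNReal.tendsto_inv_nat_nhds_zero (fun k => zero_le) (fun k => (hv k).2.2)
  intro ε hε
  obtain ⟨δ₀, hδ₀, hsub⟩ := hK.exists_cthickening_subset_open hΩ hKΩ
  set K' := cthickening δ₀ K with hK'
  have hK'c : IsCompact K' := hK.cthickening
  have hKK' : K ⊆ K' := self_subset_cthickening K
  have hum' : MemLp (K'.indicator u) (ENNReal.ofReal q) volume :=
    (memLp_indicator_iff_restrict hK'c.measurableSet).2 (hu.1 K' hK'c hsub).1
  have hDum' : MemLp (K'.indicator Du) (ENNReal.ofReal q) volume :=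
    (memLp_indicator_iff_restrict hK'c.measurableSet).2 (hu.1 K' hK'c hsub).2
  obtain ⟨δ₁, hδ₁, H1⟩ := mollify_conv hq (hum.indicator hK'c.measurableSet) hum' hε
  obtain ⟨δ₂, hδ₂, H2⟩ := mollify_conv hq (hDum.indicator hK'c.measurableSet) hDum' hε
  set δ := min δ₀ (min δ₁ δ₂) with hδ
  have hδpos : 0 < δ := by positivity
  let ρ : ContDiffBump (0 : EuclideanSpace ℝ (Fin n)) := ⟨δ / 4, δ / 2, by linarith, by linarith⟩
  have hρ : ρ.rOut < δ := by show δ / 2 < δ; linarith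
  have hloc := hum'.locallyIntegrable (by simpa using hq)
  have hlocD := hDum'.locallyIntegrable (by simpa using hq)
  refine ⟨ρ.normed volume ⋆[ContinuousLinearMap.lsmul ℝ ℝ, volume] (K'.indicator u), ?_, ?_, ?_⟩
  · exact (ρ.hasCompactSupport_normed).contDiff_convolution_left (n := 1) _ ρ.contDiff_normed hloc
  · refine le_trans ?_ (H1 ρ (hρ.trans_le ((min_le_right _ _).trans (min_le_left _ _))))
    refine le_trans (le_of_eq ?_) (eLpNorm_mono_measure _ (Measure.restrict_le_self (s := K)))
    refine eLpNorm_congr_ae ?_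
    filter_upwards [ae_restrict_mem hK.measurableSet] with x hx
    simp [hKK' hx]
  · refine le_trans ?_ (H2 ρ (hρ.trans_le ((min_le_right _ _).trans (min_le_right _ _))))
    refine le_trans (le_of_eq ?_) (eLpNorm_mono_measure _ (Measure.restrict_le_self (s := K)))
    refine eLpNorm_congr_ae ?_
    filter_upwards [ae_restrict_mem hK.measurableSet] with x hx
    rw [gradient_moll hq hu K' hK'c hsub hΩ ρ x ?_ hloc hlocD]
    · simp [hKK' hx]
    · refine (closedBall_subset_closedBall (hρ.le.trans (min_le_left _ _))).trans ?_
      exact closedBall_subset_cthickening hx δ₀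

open MeasureTheory Metric
open scoped RealInnerProductSpace ENNReal
set_option linter.unusedVariables false

lemma shift_lint {n : ℕ} (F : EuclideanSpace ℝ (Fin n) → ℝ≥0∞)
    {K K' : Set (EuclideanSpace ℝ (Fin n))} (hK : MeasurableSet K) (hK' : MeasurableSet K')
    (h : EuclideanSpace ℝ (Fin n)) (hh : ∀ x ∈ K, x + h ∈ K') :
    ∫⁻ x in K, F (x + h) ≤ ∫⁻ x in K', F x := by
  rw [← lintegral_indicator hK, ← lintegral_indicator hK',
    ← lintegral_add_right_eq_self (K'.indicator F) h]
  refine lintegral_mono fun x => ?_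
  by_cases hx : x ∈ K
  · simp [hx, hh x hx]
  · simp [hx]

lemma shift_eLp {n : ℕ} {W : Type*} [NormedAddCommGroup W] (F : EuclideanSpace ℝ (Fin n) → W)
    {q : ℝ} (hq : 0 < q)
    {K K' : Set (EuclideanSpace ℝ (Fin n))} (hK : MeasurableSet K) (hK' : MeasurableSet K')
    (h : EuclideanSpace ℝ (Fin n)) (hh : ∀ x ∈ K, x + h ∈ K') :
    eLpNorm (fun x => F (x + h)) (ENNReal.ofReal q) (volume.restrict K) ≤
      eLpNorm F (ENNReal.ofReal q) (volume.restrict K') := by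
  rw [eLpNorm_ofReal_eq _ _ hq, eLpNorm_ofReal_eq _ _ hq]
  exact ENNReal.rpow_le_rpow (shift_lint (fun x => ‖F x‖ₑ ^ q) hK hK' h hh) (by positivity)

lemma gradient_continuous {n : ℕ} {v : EuclideanSpace ℝ (Fin n) → ℝ} (hv : ContDiff ℝ 1 v) :
    Continuous (gradient v) := by
  unfold gradient
  exact (LinearIsometryEquiv.continuous _).comp (hv.continuous_fderiv (by norm_num))

lemma diff_smooth {n : ℕ} {v : EuclideanSpace ℝ (Fin n) → ℝ} (hv : ContDiff ℝ 1 v) {q : ℝ}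
    (hq : 1 ≤ q)
    {K K' : Set (EuclideanSpace ℝ (Fin n))} (hK : MeasurableSet K) (hK' : MeasurableSet K')
    (h : EuclideanSpace ℝ (Fin n)) (hh : ∀ x ∈ K, ∀ t ∈ Set.Icc (0 : ℝ) 1, x + t • h ∈ K') :
    eLpNorm (fun x => v (x + h) - v x) (ENNReal.ofReal q) (volume.restrict K) ≤
      ‖h‖ₑ * eLpNorm (gradient v) (ENNReal.ofReal q) (volume.restrict K') := by
  have hq0 : 0 < q := by linarith
  have hgc := gradient_continuous hv
  have hgm : Measurable (gradient v) := hgc.measurable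
  set ν : Measure ℝ := volume.restrict (Set.Ioc (0 : ℝ) 1)
  have hνp : IsProbabilityMeasure ν := ⟨by simp [ν]⟩
  have hpt : ∀ x, ‖v (x + h) - v x‖ₑ ≤ ∫⁻ t, ‖gradient v (x + t • h)‖ₑ * ‖h‖ₑ ∂ν := by
    intro x
    have hd : ∀ t ∈ Set.uIcc (0 : ℝ) 1, HasDerivAt (fun t : ℝ => v (x + t • h))
        (⟪gradient v (x + t • h), h⟫) t := by
      intro t _
      rw [inner_gradient_eq]
      have h1 : HasFDerivAt v (fderiv ℝ v (x + t • h)) (x + t • h) :=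
        (hv.differentiable (by norm_num) _).hasFDerivAt
      have h2 : HasDerivAt (fun t : ℝ => x + t • h) h t := by
        simpa using ((hasDerivAt_id t).smul_const h).const_add x
      exact h1.comp_hasDerivAt t h2
    have hcont : Continuous (fun t : ℝ => ⟪gradient v (x + t • h), h⟫) := by fun_prop
    have hftc := intervalIntegral.integral_eq_sub_of_hasDerivAt hd (hcont.intervalIntegrable _ _)
    simp only [one_smul, zero_smul, add_zero] at hftc
    rw [← hftc, intervalIntegral.integral_of_le zero_le_one]
    refine (enorm_integral_le_lintegral_enorm _).trans (lintegral_mono fun t => ?_)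
    have := norm_inner_le_norm (𝕜 := ℝ) (gradient v (x + t • h)) h
    rw [← ofReal_norm, ← ofReal_norm, ← ofReal_norm,
      ← ENNReal.ofReal_mul (norm_nonneg _)]
    exact ENNReal.ofReal_le_ofReal this
  have hmain : ∫⁻ x in K, ‖v (x + h) - v x‖ₑ ^ q ≤
      ‖h‖ₑ ^ q * ∫⁻ x in K', ‖gradient v x‖ₑ ^ q := by
    calc _ ≤ ∫⁻ x in K, ∫⁻ t, (‖gradient v (x + t • h)‖ₑ * ‖h‖ₑ) ^ q ∂ν := by
          refine lintegral_mono fun x => ?_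
          refine (ENNReal.rpow_le_rpow (hpt x) hq0.le).trans ?_
          exact jensen_rpow ν (by fun_prop) hq
      _ = ∫⁻ t, ∫⁻ x in K, (‖gradient v (x + t • h)‖ₑ * ‖h‖ₑ) ^ q ∂volume ∂ν := by
          apply lintegral_lintegral_swap
          fun_prop
      _ ≤ ∫⁻ t, (‖h‖ₑ ^ q * ∫⁻ x in K', ‖gradient v x‖ₑ ^ q) ∂ν := by
          refine lintegral_mono_ae ?_
          filter_upwards [ae_restrict_mem measurableSet_Ioc] with t ht
          have e : ∀ x, (‖gradient v (x + t • h)‖ₑ * ‖h‖ₑ) ^ q =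
              ‖h‖ₑ ^ q * ‖gradient v (x + t • h)‖ₑ ^ q := fun x => by
            rw [ENNReal.mul_rpow_of_nonneg _ _ hq0.le, mul_comm]
          simp_rw [e]
          rw [lintegral_const_mul _ (by fun_prop)]
          exact mul_le_mul' le_rfl (shift_lint (fun x => ‖gradient v x‖ₑ ^ q) hK hK' (t • h)
            (fun x hx => hh x hx t ⟨ht.1.le, ht.2⟩))
      _ = _ := by simp
  rw [eLpNorm_ofReal_eq _ _ hq0, eLpNorm_ofReal_eq _ _ hq0]
  refine (ENNReal.rpow_le_rpow hmain (by positivity)).trans_eq ?_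
  rw [ENNReal.mul_rpow_of_nonneg _ _ (by positivity), ← ENNReal.rpow_mul,
    mul_one_div_cancel hq0.ne', ENNReal.rpow_one]

lemma diff_u {n : ℕ} {q : ℝ} (hq : 1 ≤ q) {Ω : Set (EuclideanSpace ℝ (Fin n))}
    {u : EuclideanSpace ℝ (Fin n) → ℝ}
    {Du : EuclideanSpace ℝ (Fin n) → EuclideanSpace ℝ (Fin n)} (hum : Measurable u)
    (hDum : Measurable Du)
    (hu : MemW1Loc n q Ω u Du) (hΩ : IsOpen Ω) {K K' : Set (EuclideanSpace ℝ (Fin n))}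
    (hK : IsCompact K) (hK' : IsCompact K') (hKΩ : K' ⊆ Ω)
    (h : EuclideanSpace ℝ (Fin n)) (hh : ∀ x ∈ K, ∀ t ∈ Set.Icc (0 : ℝ) 1, x + t • h ∈ K') :
    eLpNorm (fun x => u (x + h) - u x) (ENNReal.ofReal q) (volume.restrict K) ≤
      ‖h‖ₑ * eLpNorm Du (ENNReal.ofReal q) (volume.restrict K') := by
  obtain ⟨v, hv, h1, h2⟩ := approx_W1 hq hum hDum hu hΩ hK' hKΩ
  have hq0 : 0 < q := by linarith
  have hQ : (1 : ℝ≥0∞) ≤ ENNReal.ofReal q := by simpa using hq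
  have hKK' : K ⊆ K' := fun x hx => by simpa using hh x hx 0 (by simp)
  have hsh : ∀ x ∈ K, x + h ∈ K' := fun x hx => by simpa using hh x hx 1 (by simp)
  have key : ∀ k, eLpNorm (fun x => u (x + h) - u x) (ENNReal.ofReal q) (volume.restrict K) ≤
      (eLpNorm (fun x => v k x - u x) (ENNReal.ofReal q) (volume.restrict K') + 
      eLpNorm (fun x => v k x - u x) (ENNReal.ofReal q) (volume.restrict K')) + 
      ‖h‖ₑ * (eLpNorm (fun x => gradient (v k) x - Du x) (ENNReal.ofReal q) (volume.restrict K')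
        + eLpNorm Du (ENNReal.ofReal q) (volume.restrict K')) := by
    intro k
    have hvm : Measurable (v k) := (hv k).continuous.measurable
    have hgm : Measurable (gradient (v k)) := (gradient_continuous (hv k)).measurable
    have e : (fun x => u (x + h) - u x) = ((fun x => v k x - u x) - (fun x => v k (x + h) - u (x + h)))
        + (fun x => v k (x + h) - v k x) := by ext x; simp; ring
    have e' : gradient (v k) = (fun x => gradient (v k) x - Du x) + Du := by ext x; simp
    rw [e]
    refine (eLpNorm_add_le (by fun_prop) (by fun_prop) hQ).trans ?_
    gcongr
    · refine (eLpNorm_sub_le (by fun_prop) (by fun_prop) hQ).trans ?_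
      gcongr
      exact shift_eLp (fun x => v k x - u x) hq0 hK.measurableSet hK'.measurableSet h hsh
    · refine (diff_smooth (hv k) hq hK.measurableSet hK'.measurableSet h hh).trans ?_
      gcongr
      conv_lhs => rw [e']
      exact eLpNorm_add_le (by fun_prop) (by fun_prop) hQ
  have hlim := (h1.add h1).add (ENNReal.Tendsto.const_mul (a := ‖h‖ₑ) 
    (h2.add (tendsto_const_nhds (x := eLpNorm Du (ENNReal.ofReal q) (volume.restrict K')))) 
      (Or.inr enorm_ne_top))
  simp only [add_zero, zero_add] at hlim
  exact ge_of_tendsto' hlim key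

lemma inner_tendsto {α W : Type*} [MeasurableSpace α] [NormedAddCommGroup W]
    [InnerProductSpace ℝ W] {μ : Measure α} {p q : ℝ} (hpq : p.HolderConjugate q)
    {A B : α → W} {Bk : ℕ → α → W} (hA : MemLp A (ENNReal.ofReal p) μ)
    (hB : MemLp B (ENNReal.ofReal q) μ) (hBk : ∀ k, AEStronglyMeasurable (Bk k) μ)
    (hlim : Filter.Tendsto (fun k => eLpNorm (fun x => Bk k x - B x) (ENNReal.ofReal q) μ)
      Filter.atTop (nhds 0)) :
    Filter.Tendsto (fun k => ∫ x, ⟪A x, Bk k x⟫ ∂μ) Filter.atTop (nhds (∫ x, ⟪A x, B x⟫ ∂μ)) := by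
  have hh : ENNReal.HolderConjugate (ENNReal.ofReal p) (ENNReal.ofReal q) := hpq.ennrealOfReal
  have hb : ∀ C : α → W, AEStronglyMeasurable C μ → eLpNorm (fun x => ⟪A x, C x⟫) 1 μ ≤
      eLpNorm A (ENNReal.ofReal p) μ * eLpNorm C (ENNReal.ofReal q) μ := fun C hC => by
    have := eLpNorm_le_eLpNorm_mul_eLpNorm'_of_norm (p := ENNReal.ofReal p) (q := ENNReal.ofReal q)
      (r := 1) hA.1 hC (fun a b => (⟪a, b⟫ : ℝ)) 1
      (Filter.Eventually.of_forall fun x => by simpa using norm_inner_le_norm (𝕜 := ℝ) (A x) (C x))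
    simpa using this
  have hIntg : ∀ C : α → W, MemLp C (ENNReal.ofReal q) μ → Integrable (fun x => ⟪A x, C x⟫) μ := 
    fun C hC => by
      rw [← memLp_one_iff_integrable]
      exact ⟨hA.1.inner hC.1, (hb C hC.1).trans_lt (ENNReal.mul_lt_top hA.2 hC.2)⟩
  refine tendsto_integral_of_L1' _ (hIntg B hB).1 ?_ ?_
  · have : ∀ᶠ k in Filter.atTop, eLpNorm (fun x => Bk k x - B x) (ENNReal.ofReal q) μ < 1 :=
      hlim.eventually_lt_const (by simp)
    filter_upwards [this] with k hk
    apply hIntg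
    have : Bk k = (fun x => Bk k x - B x) + B := by ext x; simp
    rw [this]
    exact MemLp.add ⟨(hBk k).sub hB.1, hk.trans (by simp)⟩ hB
  · refine tendsto_of_tendsto_of_tendsto_of_le_of_le tendsto_const_nhds (h := fun k => 
      eLpNorm A (ENNReal.ofReal p) μ * eLpNorm (fun x => Bk k x - B x) (ENNReal.ofReal q) μ) ?_ 
      (fun k => zero_le) (fun k => ?_)
    · simpa using ENNReal.Tendsto.const_mul hlim (Or.inr hA.2.ne)
    · refine le_trans (le_of_eq ?_) (hb _ ((hBk k).sub hB.1))
      congr 1; ext x; simp [inner_sub_right]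

open MeasureTheory Metric
open scoped RealInnerProductSpace ENNReal
set_option linter.unusedVariables false

lemma inner_integrable {α W : Type*} [MeasurableSpace α] [NormedAddCommGroup W]
    [InnerProductSpace ℝ W] {μ : Measure α} {p q : ℝ} (hpq : p.HolderConjugate q)
    {A C : α → W} (hA : MemLp A (ENNReal.ofReal p) μ)
    (hC : MemLp C (ENNReal.ofReal q) μ) : Integrable (fun x => ⟪A x, C x⟫) μ := by
  have hh : ENNReal.HolderConjugate (ENNReal.ofReal p) (ENNReal.ofReal q) := hpq.ennrealOfReal
  rw [← memLp_one_iff_integrable]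
  refine MemLp.of_bilin (p := ENNReal.ofReal p) (q := ENNReal.ofReal q) (fun a b => (⟪a, b⟫ : ℝ)) 1
    hA hC (hA.1.inner hC.1) (Filter.Eventually.of_forall fun x => ?_)
  simpa using nnnorm_inner_le_nnnorm (𝕜 := ℝ) (A x) (C x)

lemma test_shift {n : ℕ} {W : Type*} [NormedAddCommGroup W] [InnerProductSpace ℝ W]
    [MeasurableSpace W] [BorelSpace W] [SecondCountableTopology W]
    {Ω K' S : Set (EuclideanSpace ℝ (Fin n))} (hK' : MeasurableSet K') (hK'Ω : K' ⊆ Ω)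
    (hS : IsCompact S)
    {A ψ : EuclideanSpace ℝ (Fin n) → W} (hA : Measurable A) (hAi : IntegrableOn A K' volume)
    (hψ : Continuous ψ) (hψS : ∀ x, x ∉ S → ψ x = 0) (h : EuclideanSpace ℝ (Fin n))
    (hSK : S ⊆ K') (hShK : ∀ x ∈ S, x + h ∈ K') :
    ∫ x in Ω, ⟪A x, ψ (x - h) - ψ x⟫ = ∫ x in S, ⟪A (x + h) - A x, ψ x⟫ := by
  have hz1 : ∀ x, x ∉ K' → ψ x = 0 := fun x hx => hψS x (fun h' => hx (hSK h'))
  have hz2 : ∀ x, x ∉ K' → ψ (x - h) = 0 := fun x hx => hψS _ (fun h' => hx (by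
    simpa using hShK _ h'))
  have hcs : HasCompactSupport ψ := HasCompactSupport.of_support_subset_isCompact hS (fun x hx => by
    by_contra h'; exact hx (hψS x h'))
  obtain ⟨C, hC⟩ := hcs.exists_bound_of_continuous hψ
  have hAi' : Integrable (K'.indicator A) volume := (integrable_indicator_iff hK').2 hAi
  have hIntg : ∀ ψ' : EuclideanSpace ℝ (Fin n) → W, Continuous ψ' → (∀ x, x ∉ K' → ψ' x = 0) →
      (∀ x, ‖ψ' x‖ ≤ C) → Integrable (fun x => ⟪A x, ψ' x⟫) volume := by
    intro ψ' hc hz hb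
    refine Integrable.mono' (hAi'.norm.mul_const C) ?_ (Filter.Eventually.of_forall fun x => ?_)
    · have := hc.measurable
      exact (hA.inner this).aestronglyMeasurable
    · by_cases hx : x ∈ K'
      · simp only [Set.indicator_of_mem hx]
        exact (norm_inner_le_norm _ _).trans (by gcongr; exact hb x)
      · simp [hx, hz x hx]
  have i1 := hIntg (fun x => ψ (x - h)) (by fun_prop) hz2 (fun x => hC _)
  have i2 := hIntg ψ hψ hz1 hC
  rw [setIntegral_eq_integral_of_forall_compl_eq_zero (fun x hx => by
    rw [hz1 x (fun h' => hx (hK'Ω h')), hz2 x (fun h' => hx (hK'Ω h'))]; simp)]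
  rw [setIntegral_eq_integral_of_forall_compl_eq_zero (fun x hx => by
    rw [hψS x hx]; simp)]
  simp only [inner_sub_right, inner_sub_left]
  have e1 : ∫ x, ⟪A (x + h), ψ x⟫ = ∫ x, ⟪A x, ψ (x - h)⟫ := by
    rw [← integral_add_right_eq_self (fun x => ⟪A x, ψ (x - h)⟫) h]
    simp
  have i3 : Integrable (fun x => ⟪A (x + h), ψ x⟫) volume := by
    simpa using i1.comp_add_right h
  rw [integral_sub i1 i2, integral_sub i3 i2, e1]

lemma grad_prod {n : ℕ} {η v : EuclideanSpace ℝ (Fin n) → ℝ} (hη : ContDiff ℝ 1 η)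
    (hv : ContDiff ℝ 1 v) (h x : EuclideanSpace ℝ (Fin n)) :
    gradient (fun x => η x ^ 2 * (v (x + h) - v x)) x =
      (η x ^ 2) • (gradient v (x + h) - gradient v x) +
        (2 * η x * (v (x + h) - v x)) • gradient η x := by
  have dη : HasFDerivAt η (fderiv ℝ η x) x := (hη.differentiable (by norm_num) _).hasFDerivAt
  have dv : HasFDerivAt v (fderiv ℝ v x) x := (hv.differentiable (by norm_num) _).hasFDerivAt
  have dvh : HasFDerivAt (fun x => v (x + h)) (fderiv ℝ v (x + h)) x := by
    have : HasFDerivAt v (fderiv ℝ v (x + h)) (x + h) :=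
      (hv.differentiable (by norm_num) _).hasFDerivAt
    exact (hasFDerivAt_comp_add_right h).2 this
  have := ((dη.pow 2).mul (dvh.sub dv)).fderiv
  refine ext_inner_right ℝ fun w => ?_
  rw [inner_gradient_eq]
  rw [show (fun x => η x ^ 2 * (v (x + h) - v x)) =
    ((fun x => η x ^ 2) * ((fun x => v (x + h)) - v)) from rfl]
  have h3 : fderiv ℝ ((fun x => η x ^ 2) * ((fun x => v (x + h)) - v)) x = _ := this
  rw [h3]
  simp only [inner_add_left, inner_smul_left, inner_sub_left, inner_gradient_eq]
  simp
  ring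

lemma ident_smooth {n : ℕ} {q : ℝ} {Ω K' S : Set (EuclideanSpace ℝ (Fin n))}
    {Du : EuclideanSpace ℝ (Fin n) → EuclideanSpace ℝ (Fin n)}
    {f : EuclideanSpace ℝ (Fin n) → ℝ} (hDum : Measurable Du) (hfm : Measurable f)
    (hsol : IsLocalWeakSolution n q Ω Du f)
    (hK' : IsCompact K') (hK'Ω : K' ⊆ Ω) (hS : IsCompact S)
    (hG : IntegrableOn (fun x => Hmap n (q - 1) (Du x)) K' volume)
    (hf : IntegrableOn f K' volume)
    {η v : EuclideanSpace ℝ (Fin n) → ℝ} (hη : ContDiff ℝ 1 η) (hηS : tsupport η ⊆ S)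
    (hv : ContDiff ℝ 1 v) (h : EuclideanSpace ℝ (Fin n))
    (hSK : S ⊆ K') (hShK : ∀ x ∈ S, x + h ∈ K') :
    ∫ x in S, ⟪Hmap n (q - 1) (Du (x + h)) - Hmap n (q - 1) (Du x),
      (η x ^ 2) • (gradient v (x + h) - gradient v x) +
        (2 * η x * (v (x + h) - v x)) • gradient η x⟫ =
    ∫ x in S, ⟪f (x + h) - f x, η x ^ 2 * (v (x + h) - v x)⟫ := by
  set ψ : EuclideanSpace ℝ (Fin n) → ℝ := fun x => η x ^ 2 * (v (x + h) - v x) with hψ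
  have hψd : ContDiff ℝ 1 ψ := by
    have : ContDiff ℝ 1 (fun x => v (x + h)) := hv.comp (contDiff_id.add contDiff_const)
    exact (hη.pow 2).mul (this.sub hv)
  have hηz : ∀ x, x ∉ S → η x = 0 := fun x hx => image_eq_zero_of_notMem_tsupport
    (fun h' => hx (hηS h'))
  have hψz : ∀ x, x ∉ S → ψ x = 0 := fun x hx => by simp [hψ, hηz x hx]
  have hgηz : ∀ x, x ∉ S → gradient η x = 0 := by
    intro x hx
    have : fderiv ℝ η x = 0 := by
      have := mt (fun h => support_fderiv_subset ℝ h) (fun h' => hx (hηS h'))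
      simpa using this
    simp [gradient, this]
  have hgψz : ∀ x, x ∉ S → gradient ψ x = 0 := fun x hx => by
    rw [hψ, grad_prod hη hv, hηz x hx]; simp
  set φ : EuclideanSpace ℝ (Fin n) → ℝ := fun x => ψ (x - h) - ψ x with hφ
  have hφd : ContDiff ℝ 1 φ := (hψd.comp (contDiff_id.sub contDiff_const)).sub hψd
  have hφs : Function.support φ ⊆ K' := by
    intro x hx
    by_contra hxK
    apply hx
    simp only [hφ]
    rw [hψz x (fun h' => hxK (hSK h')), hψz (x - h) (fun h' => hxK (by simpa using hShK _ h'))]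
    simp
  have hsolφ := hsol φ hφd (HasCompactSupport.of_support_subset_isCompact hK' hφs)
    ((closure_minimal hφs hK'.isClosed).trans hK'Ω)
  have hgφ : ∀ x, gradient φ x = gradient ψ (x - h) - gradient ψ x := by
    intro x
    have d1 : HasFDerivAt ψ (fderiv ℝ ψ x) x := (hψd.differentiable (by norm_num) _).hasFDerivAt
    have d2 : HasFDerivAt (fun x => ψ (x - h)) (fderiv ℝ ψ (x - h)) x := by
      have : HasFDerivAt ψ (fderiv ℝ ψ (x - h)) (x - h) :=
        (hψd.differentiable (by norm_num) _).hasFDerivAt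
      exact (hasFDerivAt_comp_sub h).2 this
    have h3 : fderiv ℝ φ x = _ := (d2.sub d1).fderiv
    simp [gradient, h3]
  have t1 := test_shift hK'.measurableSet hK'Ω hS ((Hmap_measurable (q - 1)).comp hDum) hG
    (gradient_continuous hψd) hgψz h hSK hShK
  have t2 := test_shift hK'.measurableSet hK'Ω hS hfm hf hψd.continuous hψz h hSK hShK
  have e1 : ∫ x in Ω, f x * φ x = ∫ x in Ω, ⟪f x, ψ (x - h) - ψ x⟫ := by
    congr 1; ext1 x; simp [hφ, mul_comm]
  rw [e1, t2] at hsolφ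
  simp_rw [hgφ] at hsolφ
  have t1' := t1.symm.trans hsolφ
  simpa only [hψ, grad_prod hη hv, Function.comp] using t1'

lemma Bop_bound {n : ℕ} {q : ℝ} (hq : 1 ≤ q) {K' S : Set (EuclideanSpace ℝ (Fin n))}
    (hK' : IsCompact K') (hS : IsCompact S)
    {η w : EuclideanSpace ℝ (Fin n) → ℝ} {Z : EuclideanSpace ℝ (Fin n) → EuclideanSpace ℝ (Fin n)}
    (hη : ContDiff ℝ 1 η) (hη1 : ∀ x, |η x| ≤ 1) {C : ℝ} (hC : ∀ x, ‖gradient η x‖ ≤ C)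
    (hw : Measurable w) (hZ : Measurable Z) (h : EuclideanSpace ℝ (Fin n))
    (hSK : S ⊆ K') (hShK : ∀ x ∈ S, x + h ∈ K') :
    eLpNorm (fun x => (η x ^ 2) • (Z (x + h) - Z x) + (2 * η x * (w (x + h) - w x)) • gradient η x)
      (ENNReal.ofReal q) (volume.restrict S) ≤
      2 * eLpNorm Z (ENNReal.ofReal q) (volume.restrict K') +
      ENNReal.ofReal (2 * C) * (2 * eLpNorm w (ENNReal.ofReal q) (volume.restrict K')) ∧
    eLpNorm (fun x => η x ^ 2 * (w (x + h) - w x))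
      (ENNReal.ofReal q) (volume.restrict S) ≤
      2 * eLpNorm w (ENNReal.ofReal q) (volume.restrict K') := by
  have hq0 : 0 < q := by linarith
  have hQ : (1 : ℝ≥0∞) ≤ ENNReal.ofReal q := by simpa using hq
  have hηm : Measurable η := hη.continuous.measurable
  have hgm : Measurable (gradient η) := (gradient_continuous hη).measurable
  have hτ : ∀ {W : Type} [NormedAddCommGroup W] [MeasurableSpace W] [BorelSpace W]
      [SecondCountableTopology W] (Y : EuclideanSpace ℝ (Fin n) → W) (hY : Measurable Y),
      eLpNorm (fun x => Y (x + h) - Y x) (ENNReal.ofReal q) (volume.restrict S) ≤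
        2 * eLpNorm Y (ENNReal.ofReal q) (volume.restrict K') := by
    intro W _ _ _ _ Y hY
    refine (eLpNorm_sub_le (f := fun x => Y (x + h)) (hY.comp (measurable_add_const h)).aestronglyMeasurable hY.aestronglyMeasurable hQ).trans ?_
    rw [two_mul]
    gcongr
    exact shift_eLp Y hq0 hS.measurableSet hK'.measurableSet h hShK
  have hη2 : ∀ x, |η x ^ 2| ≤ 1 := fun x => by
    rw [abs_pow]; exact pow_le_one₀ (abs_nonneg _) (hη1 x)
  constructor
  · refine (eLpNorm_add_le (by fun_prop) (by fun_prop) hQ).trans ?_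
    refine add_le_add ?_ ?_
    · refine le_trans (eLpNorm_mono fun x => ?_) (hτ Z hZ)
      rw [norm_smul]
      exact mul_le_of_le_one_left (norm_nonneg _) (hη2 x)
    · refine le_trans (eLpNorm_le_mul_eLpNorm_of_ae_le_mul (g := fun x => w (x + h) - w x)
        (c := 2 * C) (Filter.Eventually.of_forall fun x => ?_) _) ?_
      · rw [norm_smul, norm_mul, norm_mul]
        have := hη1 x
        have := hC x
        have h1 : ‖η x‖ * ‖gradient η x‖ ≤ 1 * C := by
          gcongr
          exact hη1 x
        have h2 := norm_nonneg (w (x + h) - w x)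
        simp only [Real.norm_ofNat]
        nlinarith
      · gcongr
        exact hτ w hw
  · refine le_trans (eLpNorm_mono fun x => ?_) (hτ w hw)
    rw [norm_mul]
    exact mul_le_of_le_one_left (norm_nonneg _) (hη2 x)

open MeasureTheory Metric
open scoped RealInnerProductSpace ENNReal
set_option linter.unusedVariables false

lemma memLp_shift_sub {n : ℕ} {W : Type*} [NormedAddCommGroup W] [MeasurableSpace W] [BorelSpace W]
    [SecondCountableTopology W] {Y : EuclideanSpace ℝ (Fin n) → W} (hYm : Measurable Y) {p : ℝ}
    (hp : 0 < p) {K' S : Set (EuclideanSpace ℝ (Fin n))}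
    (hK' : MeasurableSet K') (hS : MeasurableSet S)
    (hY : MemLp Y (ENNReal.ofReal p) (volume.restrict K')) (h : EuclideanSpace ℝ (Fin n))
    (hSK : S ⊆ K') (hShK : ∀ x ∈ S, x + h ∈ K') :
    MemLp (fun x => Y (x + h) - Y x) (ENNReal.ofReal p) (volume.restrict S) := by
  have h1 : MemLp (fun x => Y (x + h)) (ENNReal.ofReal p) (volume.restrict S) :=
    ⟨(hYm.comp (measurable_add_const h)).aestronglyMeasurable,
      (shift_eLp Y hp hS hK' h hShK).trans_lt hY.2⟩
  exact h1.sub (hY.mono_measure (Measure.restrict_mono hSK le_rfl))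

lemma ident {n : ℕ} {p q : ℝ} (hpq : p.HolderConjugate q)
    {Ω K' S : Set (EuclideanSpace ℝ (Fin n))}
    {u : EuclideanSpace ℝ (Fin n) → ℝ}
    {Du : EuclideanSpace ℝ (Fin n) → EuclideanSpace ℝ (Fin n)}
    {f : EuclideanSpace ℝ (Fin n) → ℝ} (hum : Measurable u) (hDum : Measurable Du)
    (hfm : Measurable f) (hu : MemW1Loc n q Ω u Du)
    (hsol : IsLocalWeakSolution n q Ω Du f) (hΩ : IsOpen Ω)
    (hK' : IsCompact K') (hK'Ω : K' ⊆ Ω) (hS : IsCompact S)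
    (hG : MemLp (fun x => Hmap n (q - 1) (Du x)) (ENNReal.ofReal p) (volume.restrict K'))
    (hf : MemLp f (ENNReal.ofReal p) (volume.restrict K'))
    {η : EuclideanSpace ℝ (Fin n) → ℝ} (hη : ContDiff ℝ 1 η) (hηS : tsupport η ⊆ S)
    (hη1 : ∀ x, |η x| ≤ 1) {C : ℝ} (hC : ∀ x, ‖gradient η x‖ ≤ C)
    (h : EuclideanSpace ℝ (Fin n))
    (hSK : S ⊆ K') (hShK : ∀ x ∈ S, x + h ∈ K') :
    IntegrableOn (fun x => ⟪Hmap n (q - 1) (Du (x + h)) - Hmap n (q - 1) (Du x),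
      (η x ^ 2) • (Du (x + h) - Du x) +
        (2 * η x * (u (x + h) - u x)) • gradient η x⟫) S volume ∧
    IntegrableOn (fun x => ⟪f (x + h) - f x, η x ^ 2 * (u (x + h) - u x)⟫) S volume ∧
    ∫ x in S, ⟪Hmap n (q - 1) (Du (x + h)) - Hmap n (q - 1) (Du x),
      (η x ^ 2) • (Du (x + h) - Du x) +
        (2 * η x * (u (x + h) - u x)) • gradient η x⟫ =
    ∫ x in S, ⟪f (x + h) - f x, η x ^ 2 * (u (x + h) - u x)⟫ := by
  have hp1 : 1 < p := hpq.lt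
  have hq1 : 1 < q := hpq.symm.lt
  have hηm : Measurable η := hη.continuous.measurable
  have hgm : Measurable (gradient η) := (gradient_continuous hη).measurable
  have hGm : Measurable (fun x => Hmap n (q - 1) (Du x)) := (Hmap_measurable (q - 1)).comp hDum
  have hτG := memLp_shift_sub hGm (by linarith) hK'.measurableSet hS.measurableSet hG h hSK hShK
  have hτf := memLp_shift_sub hfm (by linarith) hK'.measurableSet hS.measurableSet hf h hSK hShK
  obtain ⟨huL, hDuL⟩ := hu.1 K' hK' hK'Ω
  have hB := Bop_bound hq1.le hK' hS hη hη1 hC hum hDum h hSK hShK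
  have hfin1 : 2 * eLpNorm u (ENNReal.ofReal q) (volume.restrict K') < ∞ :=
    ENNReal.mul_lt_top (by simp) huL.2
  have hfin2 : 2 * eLpNorm Du (ENNReal.ofReal q) (volume.restrict K') < ∞ :=
    ENNReal.mul_lt_top (by simp) hDuL.2
  have mB : MemLp (fun x => (η x ^ 2) • (Du (x + h) - Du x) +
        (2 * η x * (u (x + h) - u x)) • gradient η x) (ENNReal.ofReal q) (volume.restrict S) :=
    ⟨by fun_prop, hB.1.trans_lt (ENNReal.add_lt_top.2 ⟨hfin2,
      ENNReal.mul_lt_top ENNReal.ofReal_lt_top hfin1⟩)⟩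
  have mb : MemLp (fun x => η x ^ 2 * (u (x + h) - u x)) (ENNReal.ofReal q) (volume.restrict S) :=
    ⟨by fun_prop, hB.2.trans_lt hfin1⟩
  refine ⟨inner_integrable hpq hτG mB, inner_integrable hpq hτf mb, ?_⟩
  obtain ⟨v, hv, h1, h2⟩ := approx_W1 hq1.le hum hDum hu hΩ hK' hK'Ω
  have hvm : ∀ k, Measurable (v k) := fun k => (hv k).continuous.measurable
  have hvgm : ∀ k, Measurable (gradient (v k)) := fun k => (gradient_continuous (hv k)).measurable
  have hBk := fun k => Bop_bound hq1.le hK' hS hη hη1 hC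
    (w := fun x => v k x - u x) (Z := fun x => gradient (v k) x - Du x)
    ((hvm k).sub hum) ((hvgm k).sub hDum) h hSK hShK
  have lim0 : Filter.Tendsto (fun k => 2 * eLpNorm (fun x => v k x - u x) (ENNReal.ofReal q)
      (volume.restrict K')) Filter.atTop (nhds 0) := by
    simpa using ENNReal.Tendsto.const_mul (a := 2) h1 (Or.inr (by simp))
  have lim1 : Filter.Tendsto (fun k => 2 * eLpNorm (fun x => gradient (v k) x - Du x)
      (ENNReal.ofReal q) (volume.restrict K') + ENNReal.ofReal (2 * C) * (2 *
      eLpNorm (fun x => v k x - u x) (ENNReal.ofReal q)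
      (volume.restrict K'))) Filter.atTop (nhds 0) := by
    have a := ENNReal.Tendsto.const_mul (a := 2) h2 (Or.inr (by simp))
    have b := ENNReal.Tendsto.const_mul (a := ENNReal.ofReal (2 * C)) lim0 (Or.inr ENNReal.ofReal_ne_top)
    simpa only [mul_zero, add_zero] using a.add b
  have T1 := inner_tendsto hpq hτG mB (Bk := fun k x =>
      (η x ^ 2) • (gradient (v k) (x + h) - gradient (v k) x) +
        (2 * η x * (v k (x + h) - v k x)) • gradient η x)
      (fun k => by
        have := hvm k
        have := hvgm k
        fun_prop)
      (tendsto_of_tendsto_of_tendsto_of_le_of_le tendsto_const_nhds lim1 (fun _ => zero_le)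
        (fun k => by
          refine le_trans (le_of_eq ?_) (hBk k).1
          congr 1
          ext1 x
          module))
  have T2 := inner_tendsto hpq hτf mb (Bk := fun k x => η x ^ 2 * (v k (x + h) - v k x))
      (fun k => by
        have := hvm k
        fun_prop)
      (tendsto_of_tendsto_of_tendsto_of_le_of_le tendsto_const_nhds lim0 (fun _ => zero_le)
        (fun k => by
          refine le_trans (le_of_eq ?_) (hBk k).2
          congr 1
          ext1 x
          ring))
  haveI : IsFiniteMeasure (volume.restrict K') := ⟨by
    simpa using hK'.measure_lt_top⟩
  have hP : (1 : ℝ≥0∞) ≤ ENNReal.ofReal p := by simpa using hp1.le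
  refine tendsto_nhds_unique T1 (T2.congr fun k => ?_)
  exact (ident_smooth hDum hfm hsol hK' hK'Ω hS (hG.integrable hP) (hf.integrable hP) hη hηS
    (hv k) h hSK hShK).symm

lemma G_memLp {n : ℕ} {p q : ℝ} (hpq : p.HolderConjugate q)
    {Du : EuclideanSpace ℝ (Fin n) → EuclideanSpace ℝ (Fin n)} (hDum : Measurable Du)
    {μ : Measure (EuclideanSpace ℝ (Fin n))} (hDu : MemLp Du (ENNReal.ofReal q) μ) :
    MemLp (fun x => Hmap n (q - 1) (Du x)) (ENNReal.ofReal p) μ := by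
  have hp1 : 1 < p := hpq.lt
  have hq1 : 1 < q := hpq.symm.lt
  have hGm : Measurable (fun x => Hmap n (q - 1) (Du x)) := (Hmap_measurable (q - 1)).comp hDum
  rw [memLp_ofReal_iff _ _ (by linarith) hGm.aestronglyMeasurable]
  rw [memLp_ofReal_iff _ _ (by linarith) hDum.aestronglyMeasurable] at hDu
  refine lt_of_le_of_lt (lintegral_mono fun x => ?_) hDu
  have h1 : ‖Hmap n (q - 1) (Du x)‖ ≤ ‖Du x‖ ^ (q - 1) := by
    rw [Hmap_norm _ (by linarith)]
    refine Real.rpow_le_rpow (le_max_right _ _) ?_ (by linarith)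
    exact max_le (by linarith) (norm_nonneg _)
  have h2 : (q - 1) * p = q := by
    have := hpq.symm.sub_one_mul_conj
    linarith
  calc ‖Hmap n (q - 1) (Du x)‖ₑ ^ p ≤ (‖Du x‖ₑ ^ (q - 1)) ^ p := by
        refine ENNReal.rpow_le_rpow ?_ (by linarith)
        rw [← ofReal_norm, ← ofReal_norm, ENNReal.ofReal_rpow_of_nonneg (norm_nonneg _) (by linarith)]
        exact ENNReal.ofReal_le_ofReal h1
    _ = _ := by rw [← ENNReal.rpow_mul, h2]

open MeasureTheory Metric
open scoped RealInnerProductSpace ENNReal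
set_option linter.unusedVariables false

lemma sq_mul_rpow_le {q a b : ℝ} (hq : 2 ≤ q) (ha : 0 ≤ a) (hb : 0 ≤ b) :
    a ^ 2 * b ^ (q - 2) ≤ a ^ q + b ^ q := by
  have key : ∀ m : ℝ, 0 ≤ m → m ^ 2 * m ^ (q - 2) = m ^ q := fun m hm => by
    rcases hq.eq_or_lt with rfl | h2
    · simp
    · rcases hm.eq_or_lt with rfl | h
      · rw [Real.zero_rpow (by linarith), Real.zero_rpow (by linarith)]; simp
      · rw [← Real.rpow_natCast, ← Real.rpow_add h]; congr 1; push_cast; ring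
  rcases le_total a b with h | h
  · calc a ^ 2 * b ^ (q - 2) ≤ b ^ 2 * b ^ (q - 2) := by gcongr
      _ = b ^ q := key b hb
      _ ≤ _ := by have := Real.rpow_nonneg ha q; linarith
  · calc a ^ 2 * b ^ (q - 2) ≤ a ^ 2 * a ^ (q - 2) := by
          gcongr
      _ = a ^ q := key a ha
      _ ≤ _ := by have := Real.rpow_nonneg hb q; linarith

lemma pt_est {p q α ℓ C η a X g M d F Y Z : ℝ} (hpq : p.HolderConjugate q) (hq : 2 ≤ q)
    (hα : α < 1) (hℓ : 0 < ℓ) (hℓ1 : ℓ ≤ 1) (hC : 0 ≤ C)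
    (hη0 : 0 ≤ η) (hη1 : η ≤ 1) (ha : 0 ≤ a) (hX : 2 / q * a ^ 2 ≤ X) (hg : 0 ≤ g) (hM : 0 ≤ M)
    (hgM : g ^ 2 ≤ 16 * M ^ (q - 2) * a ^ 2) (hd : 0 ≤ d) (hF : 0 ≤ F)
    (hY : |Y| ≤ 2 * η * d * (g * C)) (hZ : |Z| ≤ F * d) :
    1 / q * (η ^ 2 * a ^ 2) ≤ (η ^ 2 * X + Y - Z) + ℓ ^ (1 + α) *
      ((F / ℓ ^ α) ^ p + (1 + 16 * q * C ^ 2) * (d / ℓ) ^ q + 16 * q * C ^ 2 * M ^ q) := by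
  have hq0 : 0 < q := by linarith
  have hm : 0 ≤ M ^ (q - 2) := Real.rpow_nonneg hM _
  have e1 : 2 * η * d * (g * C) ≤ 1 / q * (η ^ 2 * a ^ 2) + 16 * q * C ^ 2 * (d ^ 2 * M ^ (q - 2)) := by
    set m := Real.sqrt (M ^ (q - 2)) with hmdef
    have hm2 : m ^ 2 = M ^ (q - 2) := Real.sq_sqrt hm
    have hm0 : 0 ≤ m := Real.sqrt_nonneg _
    have hg4 : g ≤ 4 * m * a := by
      apply le_of_sq_le_sq _ (by positivity)
      calc g ^ 2 ≤ _ := hgM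
        _ = _ := by rw [← hm2]; ring
    rw [← hm2]
    have : 0 ≤ (1 / q) * (η * a - q * (4 * C * d * m)) ^ 2 := by positivity
    have e : (1 / q) * (η * a - q * (4 * C * d * m)) ^ 2 = 1 / q * (η ^ 2 * a ^ 2) +
        16 * q * C ^ 2 * (d ^ 2 * m ^ 2) - 2 * η * d * ((4 * m * a) * C) := by
      field_simp; ring
    have : 2 * η * d * (g * C) ≤ 2 * η * d * ((4 * m * a) * C) := by gcongr
    linarith
  have hα1 : ℓ ^ 2 ≤ ℓ ^ (1 + α) := by
    rw [← Real.rpow_natCast]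
    exact Real.rpow_le_rpow_of_exponent_ge hℓ hℓ1 (by push_cast; linarith)
  have e2 : d ^ 2 * M ^ (q - 2) ≤ ℓ ^ (1 + α) * ((d / ℓ) ^ q + M ^ q) := by
    have := sq_mul_rpow_le (a := d / ℓ) (b := M) hq (by positivity) hM
    calc d ^ 2 * M ^ (q - 2) = ℓ ^ 2 * ((d / ℓ) ^ 2 * M ^ (q - 2)) := by field_simp
      _ ≤ ℓ ^ 2 * ((d / ℓ) ^ q + M ^ q) := by gcongr
      _ ≤ _ := by gcongr
  have hℓα : 0 < ℓ ^ α := Real.rpow_pos_of_pos hℓ _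
  have e3 : F * d ≤ ℓ ^ (1 + α) * ((F / ℓ ^ α) ^ p + (d / ℓ) ^ q) := by
    have hy := Real.young_inequality_of_nonneg (a := F / ℓ ^ α) (b := d / ℓ) (by positivity)
      (by positivity) hpq
    have h1 : (F / ℓ ^ α) ^ p / p ≤ (F / ℓ ^ α) ^ p :=
      div_le_self (by positivity) hpq.lt.le
    have h2 : (d / ℓ) ^ q / q ≤ (d / ℓ) ^ q :=
      div_le_self (by positivity) (by linarith)
    calc F * d = ℓ ^ (1 + α) * ((F / ℓ ^ α) * (d / ℓ)) := by
          rw [Real.rpow_add hℓ, Real.rpow_one]; field_simp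
      _ ≤ _ := by gcongr; linarith
  have e4 : η ^ 2 * (2 / q * a ^ 2) ≤ η ^ 2 * X := by gcongr
  have e5 := (abs_le.1 hY).1
  have e6 := (abs_le.1 hZ).2
  have e7 : 16 * q * C ^ 2 * (d ^ 2 * M ^ (q - 2)) ≤
      16 * q * C ^ 2 * (ℓ ^ (1 + α) * ((d / ℓ) ^ q + M ^ q)) := by gcongr
  have e8 : η ^ 2 * (2 / q * a ^ 2) = 2 * (1 / q * (η ^ 2 * a ^ 2)) := by ring
  nlinarith

lemma ofReal_split {L D A B E : ℝ} (hL : 0 ≤ L) (hD : 0 ≤ D) (hA : 0 ≤ A) (hB : 0 ≤ B)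
    (hE : 0 ≤ E) : ENNReal.ofReal (L * (A + (1 + D) * B + D * E)) = ENNReal.ofReal L *
      (ENNReal.ofReal A + ENNReal.ofReal (1 + D) * ENNReal.ofReal B +
        ENNReal.ofReal D * ENNReal.ofReal E) := by
  rw [ENNReal.ofReal_mul hL, ENNReal.ofReal_add (by positivity) (by positivity),
    ENNReal.ofReal_add hA (by positivity), ENNReal.ofReal_mul (by positivity : 0 ≤ 1 + D),
    ENNReal.ofReal_mul hD]

lemma main_est {n : ℕ} (hn : 2 ≤ n) {p q α : ℝ} (hpq : p.HolderConjugate q) (hq : 2 ≤ q)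
    (hα0 : 0 < α) (hα : α < 1)
    {Ω K K' S : Set (EuclideanSpace ℝ (Fin n))}
    {u : EuclideanSpace ℝ (Fin n) → ℝ}
    {Du : EuclideanSpace ℝ (Fin n) → EuclideanSpace ℝ (Fin n)}
    {f : EuclideanSpace ℝ (Fin n) → ℝ} (hum : Measurable u) (hDum : Measurable Du)
    (hfm : Measurable f) (hu : MemW1Loc n q Ω u Du)
    (hsol : IsLocalWeakSolution n q Ω Du f) (hΩ : IsOpen Ω)
    (hK' : IsCompact K') (hK'Ω : K' ⊆ Ω) (hS : IsCompact S)
    (hf : MemLp f (ENNReal.ofReal p) (volume.restrict K'))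
    {η : EuclideanSpace ℝ (Fin n) → ℝ} (hη : ContDiff ℝ 1 η) (hηS : tsupport η ⊆ S)
    (hη0 : ∀ x, 0 ≤ η x) (hη1 : ∀ x, η x ≤ 1) (hKS : K ⊆ S) (hKm : MeasurableSet K)
    (hηK : ∀ x ∈ K, η x = 1)
    {C N Cf : ℝ} (hC0 : 0 ≤ C) (hN0 : 0 ≤ N) (hCf : 0 ≤ Cf) (hC : ∀ x, ‖gradient η x‖ ≤ C)
    (hN : eLpNorm Du (ENNReal.ofReal q) (volume.restrict K') ≤ ENNReal.ofReal N)
    (h : EuclideanSpace ℝ (Fin n)) (hh0 : h ≠ 0) (hh1 : ‖h‖ ≤ 1)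
    (hSh : ∀ x ∈ S, ∀ t ∈ Set.Icc (0 : ℝ) 1, x + t • h ∈ K')
    (hfB : ∫⁻ x in S, ‖f (x + h) - f x‖ₑ ^ p ≤ ENNReal.ofReal (Cf * ‖h‖ ^ (α * p))) :
    ∫⁻ x in K, ‖Hmap n (q / 2) (Du (x + h)) - Hmap n (q / 2) (Du x)‖ₑ ^ (2 : ℝ) ≤
      ENNReal.ofReal (q * (Cf + (1 + 16 * q * C ^ 2) * N ^ q + 16 * q * C ^ 2 * (2 * N) ^ q) *
        ‖h‖ ^ (1 + α)) := by
  have hq0 : 0 < q := by linarith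
  have hp0 : 0 < p := hpq.pos
  have hSK : S ⊆ K' := fun x hx => by simpa using hSh x hx 0 (by simp)
  have hShK : ∀ x ∈ S, x + h ∈ K' := fun x hx => by simpa using hSh x hx 1 (by simp)
  have hℓ : 0 < ‖h‖ := norm_pos_iff.2 hh0
  set ℓ := ‖h‖ with hℓdef
  have hGp := G_memLp hpq hDum (hu.1 K' hK' hK'Ω).2
  obtain ⟨I1, I2, I3⟩ := ident hpq hum hDum hfm hu hsol hΩ hK' hK'Ω hS hGp hf hη hηS
    (fun x => abs_le.2 ⟨by linarith [hη0 x], hη1 x⟩) hC h hSK hShK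
  have hVm : Measurable (fun x => Hmap n (q / 2) (Du x)) := (Hmap_measurable (q / 2)).comp hDum
  have hℓα : 0 < ℓ ^ α := Real.rpow_pos_of_pos hℓ _
  -- the three lintegrals
  have L1 : ∫⁻ x in S, ENNReal.ofReal ((|f (x + h) - f x| / ℓ ^ α) ^ p) ≤ ENNReal.ofReal Cf := by
    have : ∀ x, ENNReal.ofReal ((|f (x + h) - f x| / ℓ ^ α) ^ p) =
        ENNReal.ofReal ((ℓ ^ (α * p))⁻¹) * ‖f (x + h) - f x‖ₑ ^ p := fun x => by
      rw [← ofReal_norm, Real.norm_eq_abs, ENNReal.ofReal_rpow_of_nonneg (abs_nonneg _) hp0.le,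
        ← ENNReal.ofReal_mul (by positivity), Real.div_rpow (abs_nonneg _) hℓα.le,
        ← Real.rpow_mul hℓ.le]
      congr 1; field_simp
    simp_rw [this]
    rw [lintegral_const_mul _ (by fun_prop)]
    refine (mul_le_mul_right hfB _).trans ?_
    rw [← ENNReal.ofReal_mul (by positivity)]
    refine ENNReal.ofReal_le_ofReal (le_of_eq ?_)
    have : 0 < ℓ ^ (α * p) := Real.rpow_pos_of_pos hℓ _
    field_simp
  have L2 : ∫⁻ x in S, ENNReal.ofReal ((|u (x + h) - u x| / ℓ) ^ q) ≤ ENNReal.ofReal (N ^ q) := by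
    have hdu := diff_u (by linarith) hum hDum hu hΩ hS hK' hK'Ω h hSh
    have hdu2 : eLpNorm (fun x => u (x + h) - u x) (ENNReal.ofReal q) (volume.restrict S) ≤
        ENNReal.ofReal (ℓ * N) := by
      refine hdu.trans ?_
      rw [ENNReal.ofReal_mul hℓ.le, hℓdef, ofReal_norm]
      gcongr
    have h3 : ∫⁻ x in S, ‖u (x + h) - u x‖ₑ ^ q ≤ ENNReal.ofReal (ℓ * N) ^ q := by
      rw [← eLpNorm_ofReal_rpow _ _ hq0]
      gcongr
    have : ∀ x, ENNReal.ofReal ((|u (x + h) - u x| / ℓ) ^ q) =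
        ENNReal.ofReal ((ℓ ^ q)⁻¹) * ‖u (x + h) - u x‖ₑ ^ q := fun x => by
      rw [← ofReal_norm, Real.norm_eq_abs, ENNReal.ofReal_rpow_of_nonneg (abs_nonneg _) hq0.le,
        ← ENNReal.ofReal_mul (by positivity), Real.div_rpow (abs_nonneg _) hℓ.le]
      congr 1; field_simp
    simp_rw [this]
    rw [lintegral_const_mul _ (by fun_prop)]
    refine (mul_le_mul_right h3 _).trans ?_
    rw [ENNReal.ofReal_rpow_of_nonneg (by positivity) hq0.le, ← ENNReal.ofReal_mul (by positivity),
      Real.mul_rpow hℓ.le hN0]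
    refine ENNReal.ofReal_le_ofReal (le_of_eq ?_)
    have : 0 < ℓ ^ q := Real.rpow_pos_of_pos hℓ _
    field_simp
  have L3 : ∫⁻ x in S, ENNReal.ofReal ((‖Du (x + h)‖ + ‖Du x‖) ^ q) ≤
      ENNReal.ofReal ((2 * N) ^ q) := by
    have : ∀ x, ENNReal.ofReal ((‖Du (x + h)‖ + ‖Du x‖) ^ q) =
        ‖(‖Du (x + h)‖ + ‖Du x‖)‖ₑ ^ q := fun x => by
      rw [← ofReal_norm, Real.norm_of_nonneg (by positivity),
        ENNReal.ofReal_rpow_of_nonneg (by positivity) hq0.le]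
    simp_rw [this]
    rw [← eLpNorm_ofReal_rpow _ _ hq0, ← ENNReal.ofReal_rpow_of_nonneg (by positivity) hq0.le]
    refine ENNReal.rpow_le_rpow ?_ hq0.le
    refine (eLpNorm_add_le (f := fun x => ‖Du (x + h)‖)
      (hDum.comp (measurable_add_const h)).norm.aestronglyMeasurable hDum.norm.aestronglyMeasurable
      (by simp; linarith)).trans ?_
    rw [two_mul, ENNReal.ofReal_add hN0 hN0]
    refine add_le_add ?_ ?_
    · rw [eLpNorm_norm (fun x => Du (x + h))]
      exact (shift_eLp Du hq0 hS.measurableSet hK'.measurableSet h hShK).trans hN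
    · rw [eLpNorm_norm]
      exact (eLpNorm_mono_measure _ (Measure.restrict_mono hSK le_rfl)).trans hN
  set D := 16 * q * C ^ 2 with hD
  have hD0 : 0 ≤ D := by positivity
  set R : EuclideanSpace ℝ (Fin n) → ℝ := fun x => ℓ ^ (1 + α) *
      ((|f (x + h) - f x| / ℓ ^ α) ^ p + (1 + D) * (|u (x + h) - u x| / ℓ) ^ q +
        D * (‖Du (x + h)‖ + ‖Du x‖) ^ q) with hR
  have hR0 : ∀ x, 0 ≤ R x := fun x => by simp only [hR]; positivity
  have hRm : Measurable R := by simp only [hR]; fun_prop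
  have hRl : ∫⁻ x in S, ENNReal.ofReal (R x) ≤ ENNReal.ofReal (ℓ ^ (1 + α) *
      (Cf + (1 + D) * N ^ q + D * (2 * N) ^ q)) := by
    have : ∀ x, ENNReal.ofReal (R x) = ENNReal.ofReal (ℓ ^ (1 + α)) *
        (ENNReal.ofReal ((|f (x + h) - f x| / ℓ ^ α) ^ p) +
        ENNReal.ofReal (1 + D) * ENNReal.ofReal ((|u (x + h) - u x| / ℓ) ^ q) +
        ENNReal.ofReal D * ENNReal.ofReal ((‖Du (x + h)‖ + ‖Du x‖) ^ q)) := fun x => by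
      simp only [hR]
      exact ofReal_split (by positivity) hD0 (by positivity) (by positivity) (by positivity)
    simp_rw [this]
    rw [lintegral_const_mul _ (by fun_prop), lintegral_add_left (by fun_prop),
      lintegral_add_left (by fun_prop), lintegral_const_mul _ (by fun_prop),
      lintegral_const_mul _ (by fun_prop)]
    rw [ofReal_split (by positivity) hD0 (by positivity) (by positivity) (by positivity)]
    gcongr
  have hRi : IntegrableOn R S volume := by
    refine ⟨hRm.aestronglyMeasurable, ?_⟩
    rw [hasFiniteIntegral_iff_ofReal (Filter.Eventually.of_forall hR0)]
    exact hRl.trans_lt ENNReal.ofReal_lt_top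
  set b : EuclideanSpace ℝ (Fin n) → ℝ := fun x =>
    ⟪Hmap n (q - 1) (Du (x + h)) - Hmap n (q - 1) (Du x),
      (η x ^ 2) • (Du (x + h) - Du x) +
        (2 * η x * (u (x + h) - u x)) • gradient η x⟫ -
      ⟪f (x + h) - f x, η x ^ 2 * (u (x + h) - u x)⟫ with hb
  have hbi : IntegrableOn b S volume := I1.sub I2
  have hb0 : ∫ x in S, b x = 0 := by
    simp only [hb]; rw [integral_sub I1 I2, I3, sub_self]
  have hpt : ∀ x, 1 / q * (η x ^ 2 *
      ‖Hmap n (q / 2) (Du (x + h)) - Hmap n (q / 2) (Du x)‖ ^ 2) ≤ b x + R x := fun x => by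
    obtain ⟨H1, H2⟩ := Hineq hn hq (Du (x + h)) (Du x)
    have := pt_est (ℓ := ℓ) (C := C) (Y := ⟪Hmap n (q - 1) (Du (x + h)) - Hmap n (q - 1) (Du x),
        (2 * η x * (u (x + h) - u x)) • gradient η x⟫)
        (Z := ⟪f (x + h) - f x, η x ^ 2 * (u (x + h) - u x)⟫) (d := |u (x + h) - u x|)
        (F := |f (x + h) - f x|) hpq hq hα hℓ hh1 hC0 (hη0 x) (hη1 x)
        (norm_nonneg _) H1 (norm_nonneg _) (by positivity) H2 (abs_nonneg _) (abs_nonneg _) ?_ ?_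
    · refine this.trans (le_of_eq ?_)
      simp only [hb, hR, hD, inner_add_right, inner_smul_right]
    · refine (abs_real_inner_le_norm _ _).trans ?_
      rw [norm_smul, norm_mul, norm_mul, Real.norm_of_nonneg (hη0 x), Real.norm_ofNat]
      calc _ = 2 * η x * ‖u (x + h) - u x‖ *
          (‖Hmap n (q - 1) (Du (x + h)) - Hmap n (q - 1) (Du x)‖ * ‖gradient η x‖) := by ring
        _ ≤ _ := by
          have := hη0 x
          have := hC x
          rw [Real.norm_eq_abs]
          gcongr
    · refine (abs_real_inner_le_norm _ _).trans ?_
      rw [Real.norm_eq_abs, Real.norm_eq_abs, abs_mul]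
      gcongr
      refine mul_le_of_le_one_left (abs_nonneg _) ?_
      rw [abs_of_nonneg (by positivity)]
      exact pow_le_one₀ (hη0 x) (hη1 x)
  have hmain : ∫⁻ x in S, ENNReal.ofReal (b x + R x) ≤ ENNReal.ofReal (ℓ ^ (1 + α) *
      (Cf + (1 + D) * N ^ q + D * (2 * N) ^ q)) := by
    rw [← ofReal_integral_eq_lintegral_ofReal (f := fun x => b x + R x) (hbi.add hRi) (Filter.Eventually.of_forall fun x =>
      le_trans (by positivity) (hpt x))]
    rw [integral_add hbi hRi, hb0, zero_add,
      ofReal_integral_eq_lintegral_ofReal hRi (Filter.Eventually.of_forall hR0)]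
    exact hRl
  calc _ ≤ ∫⁻ x in K, ENNReal.ofReal q * ENNReal.ofReal (b x + R x) := by
        refine setLIntegral_mono' hKm fun x hx => ?_
        have := hpt x
        rw [hηK x hx] at this
        rw [← ENNReal.ofReal_mul hq0.le, ← ofReal_norm,
          ENNReal.ofReal_rpow_of_nonneg (norm_nonneg _) (by norm_num)]
        apply ENNReal.ofReal_le_ofReal
        rw [Real.rpow_two]
        calc _ = q * (1 / q * (1 ^ 2 *
              ‖Hmap n (q / 2) (Du (x + h)) - Hmap n (q / 2) (Du x)‖ ^ 2)) := by field_simp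
          _ ≤ _ := by gcongr
    _ ≤ ∫⁻ x in S, ENNReal.ofReal q * ENNReal.ofReal (b x + R x) := lintegral_mono_set hKS
    _ = ENNReal.ofReal q * ∫⁻ x in S, ENNReal.ofReal (b x + R x) :=
        lintegral_const_mul' _ _ ENNReal.ofReal_ne_top
    _ ≤ ENNReal.ofReal q * ENNReal.ofReal (ℓ ^ (1 + α) *
      (Cf + (1 + D) * N ^ q + D * (2 * N) ^ q)) := by gcongr
    _ = _ := by rw [← ENNReal.ofReal_mul hq0.le]; congr 1; ring

open MeasureTheory Metric
open scoped RealInnerProductSpace ENNReal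
set_option linter.unusedVariables false

lemma exists_cutoff {n : ℕ} {K S : Set (EuclideanSpace ℝ (Fin n))} (hK : IsCompact K)
    (hS : IsCompact S) (hKS : K ⊆ interior S) :
    ∃ (η : EuclideanSpace ℝ (Fin n) → ℝ) (C : ℝ), ContDiff ℝ 1 η ∧ tsupport η ⊆ S ∧
      (∀ x, 0 ≤ η x) ∧ (∀ x, η x ≤ 1) ∧ (∀ x ∈ K, η x = 1) ∧ 0 ≤ C ∧
      ∀ x, ‖gradient η x‖ ≤ C := by
  obtain ⟨η, h1, h2, h3⟩ := exists_contMDiffMap_one_nhds_of_subset_interior (n := 1)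
    (modelWithCornersSelf ℝ (EuclideanSpace ℝ (Fin n))) hK.isClosed hKS
  have hd : ContDiff ℝ 1 (η : EuclideanSpace ℝ (Fin n) → ℝ) := η.contMDiff.contDiff
  have hsup : Function.support (η : EuclideanSpace ℝ (Fin n) → ℝ) ⊆ S := fun x hx => by
    by_contra h'; exact hx (h2 x h')
  have hts : tsupport (η : EuclideanSpace ℝ (Fin n) → ℝ) ⊆ S := closure_minimal hsup hS.isClosed
  have hcs : HasCompactSupport (gradient (η : EuclideanSpace ℝ (Fin n) → ℝ)) := by
    refine HasCompactSupport.of_support_subset_isCompact hS (fun x hx => ?_)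
    by_contra h'
    apply hx
    have : fderiv ℝ (η : EuclideanSpace ℝ (Fin n) → ℝ) x = 0 := by
      have := mt (fun h => support_fderiv_subset ℝ h) (fun h'' => h' (hts h''))
      simpa using this
    simp [gradient, this]
  obtain ⟨C, hC⟩ := hcs.exists_bound_of_continuous (gradient_continuous hd)
  exact ⟨η, C, hd, hts, fun x => (h3 x).1, fun x => (h3 x).2,
    fun x hx => h1.self_of_nhdsSet x hx, (norm_nonneg _).trans (hC 0), hC⟩

lemma norm_unitVec {n : ℕ} (s : Fin n) : ‖unitVec n s‖ = 1 := by simp [unitVec]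

lemma mem_cthick {n : ℕ} {S : Set (EuclideanSpace ℝ (Fin n))} {δ : ℝ} {x z : EuclideanSpace ℝ (Fin n)}
    (hx : x ∈ S) (hz : ‖z‖ ≤ δ) : x + z ∈ cthickening δ S :=
  mem_cthickening_of_dist_le _ x _ _ hx (by simpa using hz)

lemma V_besov {n : ℕ} (hn : 2 ≤ n) {p q α : ℝ} (hpq : p.HolderConjugate q) (hq : 2 ≤ q)
    (hα0 : 0 < α) (hα : α < 1)
    {Ω : Set (EuclideanSpace ℝ (Fin n))}
    {u : EuclideanSpace ℝ (Fin n) → ℝ}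
    {Du : EuclideanSpace ℝ (Fin n) → EuclideanSpace ℝ (Fin n)}
    {f : EuclideanSpace ℝ (Fin n) → ℝ} (hum : Measurable u) (hDum : Measurable Du)
    (hfm : Measurable f) (hu : MemW1Loc n q Ω u Du)
    (hsol : IsLocalWeakSolution n q Ω Du f) (hΩ : IsOpen Ω)
    (hf : ∀ K, IsCompact K → K ⊆ Ω → MemLp f (ENNReal.ofReal p) (volume.restrict K))
    (hfB : ∀ K, IsCompact K → K ⊆ Ω → ∃ C δ : ℝ, 0 ≤ C ∧ 0 < δ ∧ ∀ (s : Fin n) (t : ℝ), t ≠ 0 →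
      |t| < δ → ∫⁻ x in K, ‖f (x + t • unitVec n s) - f x‖ₑ ^ p ≤
        ENNReal.ofReal (C * |t| ^ (α * p)))
    (K : Set (EuclideanSpace ℝ (Fin n))) (hK : IsCompact K) (hKΩ : K ⊆ Ω) :
    ∃ C δ : ℝ, 0 ≤ C ∧ 0 < δ ∧ ∀ (s : Fin n) (t : ℝ), t ≠ 0 →
      |t| < δ → ∫⁻ x in K, ‖Hmap n (q / 2) (Du (x + t • unitVec n s)) -
        Hmap n (q / 2) (Du x)‖ₑ ^ (2 : ℝ) ≤ ENNReal.ofReal (C * |t| ^ (1 + α)) := by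
  obtain ⟨S, hS, hKS, hSΩ⟩ := exists_compact_between hK hΩ hKΩ
  obtain ⟨η, C, hη, hηS, hη0, hη1, hηK, hC0, hC⟩ := exists_cutoff hK hS hKS
  obtain ⟨δ₁, hδ₁, hK'⟩ := hS.exists_cthickening_subset_open hΩ hSΩ
  obtain ⟨Cf, δ₂, hCf, hδ₂, hB⟩ := hfB S hS hSΩ
  have hK'c : IsCompact (cthickening δ₁ S) := hS.cthickening
  set N := (eLpNorm Du (ENNReal.ofReal q) (volume.restrict (cthickening δ₁ S))).toReal with hN
  refine ⟨q * (Cf + (1 + 16 * q * C ^ 2) * N ^ q + 16 * q * C ^ 2 * (2 * N) ^ q),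
    min 1 (min δ₁ δ₂), by positivity, by positivity, fun s t ht htd => ?_⟩
  have e : ‖t • unitVec n s‖ = |t| := by rw [norm_smul, norm_unitVec, mul_one, Real.norm_eq_abs]
  have hmin : |t| < 1 ∧ |t| < δ₁ ∧ |t| < δ₂ := by simpa using htd
  have := main_est hn hpq hq hα0 hα hum hDum hfm hu hsol hΩ hK'c hK' hS (hf _ hK'c hK') hη hηS
    hη0 hη1 (hKS.trans interior_subset) hK.measurableSet hηK hC0 (N := N) (by positivity) hCf hC
    (by rw [hN, ENNReal.ofReal_toReal (hu.1 _ hK'c hK').2.2.ne]) (t • unitVec n s)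
    (by rw [← norm_pos_iff, e]; positivity) (by rw [e]; linarith) ?_ (by rw [e]; exact hB s t ht hmin.2.2)
  · rwa [e] at this
  · intro x hx r hr
    refine mem_cthick hx ?_
    rw [norm_smul, e, Real.norm_of_nonneg hr.1]
    nlinarith [hr.1, hr.2, abs_nonneg t]

lemma chain_aux {n : ℕ} {σ : ℝ} (hσ : 0 < σ) {Ω : Set (EuclideanSpace ℝ (Fin n))} (hΩ : IsOpen Ω)
    {V : EuclideanSpace ℝ (Fin n) → EuclideanSpace ℝ (Fin n)} (hV : Measurable V)
    (hB : ∀ K, IsCompact K → K ⊆ Ω → ∃ C δ : ℝ, 0 ≤ C ∧ 0 < δ ∧ ∀ (s : Fin n) (t : ℝ), t ≠ 0 →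
      |t| < δ → ∫⁻ x in K, ‖V (x + t • unitVec n s) - V x‖ₑ ^ (2 : ℝ) ≤
        ENNReal.ofReal (C * |t| ^ σ)) (T : Finset (Fin n)) :
    ∀ K, IsCompact K → K ⊆ Ω → ∃ C δ : ℝ, 0 ≤ C ∧ 0 < δ ∧ ∀ z : EuclideanSpace ℝ (Fin n),
      (∀ i, i ∉ T → z i = 0) → ‖z‖ < δ → ∫⁻ x in K, ‖V (x + z) - V x‖ₑ ^ (2 : ℝ) ≤
        ENNReal.ofReal (C * ‖z‖ ^ σ) := by
  classical
  induction T using Finset.induction_on with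
  | empty =>
    intro K hK hKΩ
    refine ⟨0, 1, le_rfl, one_pos, fun z hz _ => ?_⟩
    have : z = 0 := by ext i; exact hz i (by simp)
    subst this
    simp
  | insert s T hs ih =>
    intro K hK hKΩ
    obtain ⟨δ₀, hδ₀, hK'⟩ := hK.exists_cthickening_subset_open hΩ hKΩ
    have hK'c : IsCompact (cthickening δ₀ K) := hK.cthickening
    obtain ⟨C₁, δ₁, hC₁, hδ₁, h1⟩ := hB _ hK'c hK'
    obtain ⟨C₂, δ₂, hC₂, hδ₂, h2⟩ := ih K hK hKΩ
    refine ⟨2 * C₁ + 2 * (C₂ * 2 ^ σ), min (δ₀ / 2) (min δ₁ (δ₂ / 2)), by positivity, by positivity,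
      fun z hz hzd => ?_⟩
    have hmin : ‖z‖ < δ₀ / 2 ∧ ‖z‖ < δ₁ ∧ ‖z‖ < δ₂ / 2 := by simpa using hzd
    set t := z s with ht
    have htz : |t| ≤ ‖z‖ := by simpa using PiLp.norm_apply_le z s
    set z' := z - t • unitVec n s with hz'
    have hzz : z = z' + t • unitVec n s := by simp [hz']
    have hz'n : ‖z'‖ ≤ 2 * ‖z‖ := by
      refine (norm_sub_le _ _).trans ?_
      rw [norm_smul, norm_unitVec, mul_one, Real.norm_eq_abs]; linarith
    have hz'0 : ∀ i, i ∉ T → z' i = 0 := by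
      intro i hi
      by_cases his : i = s
      · subst his; simp [hz', unitVec, ht]
      · simp [hz', unitVec, his, hz i (by simp [hi, his])]
    have A2 := h2 z' hz'0 (by linarith)
    have A1 : ∫⁻ x in K, ‖V (x + z' + t • unitVec n s) - V (x + z')‖ₑ ^ (2 : ℝ) ≤
        ENNReal.ofReal (C₁ * |t| ^ σ) := by
      by_cases ht0 : t = 0
      · simp [ht0]
      · refine le_trans (shift_lint (fun x => ‖V (x + t • unitVec n s) - V x‖ₑ ^ (2 : ℝ))
          hK.measurableSet hK'c.measurableSet z' (fun x hx => mem_cthick hx (by linarith))) ?_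
        exact h1 s t ht0 (by linarith)
    calc ∫⁻ x in K, ‖V (x + z) - V x‖ₑ ^ (2 : ℝ) ≤
        ∫⁻ x in K, (2 * ‖V (x + z' + t • unitVec n s) - V (x + z')‖ₑ ^ (2 : ℝ) +
          2 * ‖V (x + z') - V x‖ₑ ^ (2 : ℝ)) := by
          refine lintegral_mono fun x => ?_
          have e : V (x + z) - V x = (V (x + z' + t • unitVec n s) - V (x + z')) +
              (V (x + z') - V x) := by rw [hzz, add_assoc]; abel
          rw [e]
          refine (ENNReal.rpow_le_rpow (enorm_add_le _ _) (by norm_num)).trans ?_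
          have := ENNReal.rpow_add_le_mul_rpow_add_rpow (p := 2)
            ‖V (x + z' + t • unitVec n s) - V (x + z')‖ₑ ‖V (x + z') - V x‖ₑ (by norm_num)
          refine this.trans (le_of_eq ?_)
          norm_num
          rw [mul_add]
      _ = 2 * (∫⁻ x in K, ‖V (x + z' + t • unitVec n s) - V (x + z')‖ₑ ^ (2 : ℝ)) +
          2 * ∫⁻ x in K, ‖V (x + z') - V x‖ₑ ^ (2 : ℝ) := by
          rw [lintegral_add_left, lintegral_const_mul, lintegral_const_mul]
          all_goals fun_prop
      _ ≤ 2 * ENNReal.ofReal (C₁ * |t| ^ σ) + 2 * ENNReal.ofReal (C₂ * ‖z'‖ ^ σ) := by gcongr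
      _ = ENNReal.ofReal (2 * (C₁ * |t| ^ σ) + 2 * (C₂ * ‖z'‖ ^ σ)) := by
          rw [ENNReal.ofReal_add (by positivity) (by positivity),
            ENNReal.ofReal_mul (p := 2) (by norm_num), ENNReal.ofReal_mul (p := 2) (by norm_num)]
          simp
      _ ≤ _ := by
          apply ENNReal.ofReal_le_ofReal
          have a1 : |t| ^ σ ≤ ‖z‖ ^ σ := Real.rpow_le_rpow (abs_nonneg _) htz hσ.le
          have a2 : ‖z'‖ ^ σ ≤ 2 ^ σ * ‖z‖ ^ σ := by
            rw [← Real.mul_rpow (by norm_num) (norm_nonneg _)]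
            exact Real.rpow_le_rpow (norm_nonneg _) hz'n hσ.le
          have b1 := mul_le_mul_of_nonneg_left a1 hC₁
          have b2 := mul_le_mul_of_nonneg_left a2 hC₂
          nlinarith

lemma chain_all {n : ℕ} {σ : ℝ} (hσ : 0 < σ) {Ω : Set (EuclideanSpace ℝ (Fin n))} (hΩ : IsOpen Ω)
    {V : EuclideanSpace ℝ (Fin n) → EuclideanSpace ℝ (Fin n)} (hV : Measurable V)
    (hB : ∀ K, IsCompact K → K ⊆ Ω → ∃ C δ : ℝ, 0 ≤ C ∧ 0 < δ ∧ ∀ (s : Fin n) (t : ℝ), t ≠ 0 →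
      |t| < δ → ∫⁻ x in K, ‖V (x + t • unitVec n s) - V x‖ₑ ^ (2 : ℝ) ≤
        ENNReal.ofReal (C * |t| ^ σ)) :
    ∀ K, IsCompact K → K ⊆ Ω → ∃ C δ : ℝ, 0 ≤ C ∧ 0 < δ ∧ ∀ z : EuclideanSpace ℝ (Fin n),
      ‖z‖ < δ → ∫⁻ x in K, ‖V (x + z) - V x‖ₑ ^ (2 : ℝ) ≤
        ENNReal.ofReal (C * ‖z‖ ^ σ) := by
  intro K hK hKΩ
  obtain ⟨C, δ, h1, h2, h3⟩ := chain_aux hσ hΩ hV hB Finset.univ K hK hKΩ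
  exact ⟨C, δ, h1, h2, fun z hz => h3 z (by simp) hz⟩

open MeasureTheory Metric
open scoped RealInnerProductSpace ENNReal
set_option linter.unusedVariables false

lemma good_est {n : ℕ} {V : EuclideanSpace ℝ (Fin n) → EuclideanSpace ℝ (Fin n)}
    (hV : Measurable V) {K K' : Set (EuclideanSpace ℝ (Fin n))} (hK : MeasurableSet K)
    (hK' : MeasurableSet K') {ρ r : ℝ} {L T : ℝ≥0∞} (hρ : 0 < ρ) (hr : 0 < r) (hL0 : L ≠ 0)
    (hL : L ≠ ∞) (hKK' : ∀ x ∈ K, ∀ z ∈ ball (0 : EuclideanSpace ℝ (Fin n)) ρ, x + z ∈ K')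
    (hA : 2 * (∫⁻ x in K', ‖V x‖ₑ ^ r) ≤ L ^ r * volume (ball (0 : EuclideanSpace ℝ (Fin n)) ρ))
    (hz : ∀ z ∈ ball (0 : EuclideanSpace ℝ (Fin n)) ρ,
      ∫⁻ x in K, ‖V (x + z) - V x‖ₑ ^ (2 : ℝ) ≤ T) :
    L ^ (2 : ℝ) * volume ({x | 2 * L < ‖V x‖ₑ} ∩ K) ≤ 2 * T := by
  set B := ball (0 : EuclideanSpace ℝ (Fin n)) ρ with hB
  set m := volume B with hm
  have hmt : m ≠ ∞ := measure_ball_lt_top.ne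
  have hm0 : m ≠ 0 := (measure_ball_pos _ _ hρ).ne'
  have hLr0 : L ^ r ≠ 0 := by simp [ENNReal.rpow_eq_zero_iff, hL0, hL]
  have hLrt : L ^ r ≠ ∞ := ENNReal.rpow_ne_top_of_nonneg hr.le hL
  have hpt : ∀ x ∈ {x | 2 * L < ‖V x‖ₑ} ∩ K, L ^ (2 : ℝ) * m ≤
      2 * ∫⁻ z in B, ‖V (x + z) - V x‖ₑ ^ (2 : ℝ) := by
    intro x hx
    set μ := volume.restrict B with hμ
    set bad := {z | L ^ r ≤ ‖V (x + z)‖ₑ ^ r} with hbad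
    set good := {z | L ^ (2 : ℝ) ≤ ‖V (x + z) - V x‖ₑ ^ (2 : ℝ)} with hgood
    have b1 : L ^ r * μ bad ≤ ∫⁻ z in B, ‖V (x + z)‖ₑ ^ r :=
      mul_meas_ge_le_lintegral₀ (by fun_prop) _
    have b2 : ∫⁻ z in B, ‖V (x + z)‖ₑ ^ r ≤ ∫⁻ x in K', ‖V x‖ₑ ^ r := by
      have := shift_lint (fun y => ‖V y‖ₑ ^ r) (K := B) (K' := K') measurableSet_ball hK' x
        (fun z hz => by rw [add_comm]; exact hKK' x hx.2 z hz)
      simpa [add_comm] using this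
    have b3 : 2 * μ bad ≤ m := by
      have : L ^ r * (2 * μ bad) ≤ L ^ r * m := by
        calc L ^ r * (2 * μ bad) = 2 * (L ^ r * μ bad) := by ring
          _ ≤ 2 * (∫⁻ x in K', ‖V x‖ₑ ^ r) := by gcongr; exact b1.trans b2
          _ ≤ _ := hA
      exact (ENNReal.mul_le_mul_iff_right hLr0 hLrt).1 this
    have g1 : L ^ (2 : ℝ) * μ good ≤ ∫⁻ z in B, ‖V (x + z) - V x‖ₑ ^ (2 : ℝ) :=
      mul_meas_ge_le_lintegral₀ (by fun_prop) _
    have hun : m ≤ μ bad + μ good := by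
      calc m = μ Set.univ := by simp [hμ, hm]
        _ ≤ μ (bad ∪ good) := by
          refine measure_mono fun z _ => ?_
          by_contra hc
          simp only [Set.mem_union, not_or, hbad, hgood, Set.mem_ofPred_eq, not_le] at hc
          have c1 := (ENNReal.rpow_lt_rpow_iff hr).1 hc.1
          have c2 := (ENNReal.rpow_lt_rpow_iff (by norm_num : (0 : ℝ) < 2)).1 hc.2
          have c3 : ‖V x‖ₑ ≤ ‖V (x + z)‖ₑ + ‖V (x + z) - V x‖ₑ := by
            calc ‖V x‖ₑ = ‖V (x + z) - (V (x + z) - V x)‖ₑ := by congr 1; abel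
              _ ≤ _ := enorm_sub_le
          have c4 : ‖V x‖ₑ ≤ 2 * L := by
            rw [two_mul]; exact c3.trans (add_le_add c1.le c2.le)
          exact absurd hx.1 (not_lt.2 c4)
        _ ≤ _ := measure_union_le _ _
    have g2 : m ≤ 2 * μ good := by
      have : m + m ≤ m + 2 * μ good := by
        calc m + m = 2 * m := by ring
          _ ≤ 2 * (μ bad + μ good) := by gcongr
          _ = 2 * μ bad + 2 * μ good := by ring
          _ ≤ _ := by gcongr
      exact (ENNReal.add_le_add_iff_left hmt).1 this
    calc L ^ (2 : ℝ) * m ≤ L ^ (2 : ℝ) * (2 * μ good) := by gcongr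
      _ = 2 * (L ^ (2 : ℝ) * μ good) := by ring
      _ ≤ _ := by gcongr
  have hmeas : MeasurableSet ({x | 2 * L < ‖V x‖ₑ} ∩ K) :=
    (measurableSet_lt measurable_const hV.enorm).inter hK
  have hfin : m * (L ^ (2 : ℝ) * volume ({x | 2 * L < ‖V x‖ₑ} ∩ K)) ≤ m * (2 * T) := by
    calc m * (L ^ (2 : ℝ) * volume ({x | 2 * L < ‖V x‖ₑ} ∩ K))
        = ∫⁻ x in {x | 2 * L < ‖V x‖ₑ} ∩ K, L ^ (2 : ℝ) * m := by
          rw [setLIntegral_const]; ring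
      _ ≤ ∫⁻ x in {x | 2 * L < ‖V x‖ₑ} ∩ K, 2 * ∫⁻ z in B, ‖V (x + z) - V x‖ₑ ^ (2 : ℝ) :=
          setLIntegral_mono' hmeas hpt
      _ ≤ ∫⁻ x in K, 2 * ∫⁻ z in B, ‖V (x + z) - V x‖ₑ ^ (2 : ℝ) :=
          lintegral_mono_set Set.inter_subset_right
      _ = 2 * ∫⁻ z in B, ∫⁻ x in K, ‖V (x + z) - V x‖ₑ ^ (2 : ℝ) := by
          rw [lintegral_const_mul' _ _ (by simp), lintegral_lintegral_swap (by fun_prop)]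
      _ ≤ 2 * ∫⁻ z in B, T := by
          gcongr 2 * ?_
          exact setLIntegral_mono' measurableSet_ball hz
      _ = _ := by rw [setLIntegral_const]; ring
  exact (ENNReal.mul_le_mul_iff_right hm0 hmt).1 hfin

lemma two_mul_ofReal (a : ℝ) : 2 * ENNReal.ofReal a = ENNReal.ofReal (2 * a) := by
  rw [ENNReal.ofReal_mul (by norm_num)]; simp

lemma weak_type {n : ℕ} (hn : 0 < n) {σ : ℝ} (hσ : 0 < σ)
    {V : EuclideanSpace ℝ (Fin n) → EuclideanSpace ℝ (Fin n)}
    (hV : Measurable V) {K K' : Set (EuclideanSpace ℝ (Fin n))} (hK : MeasurableSet K)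
    (hK' : MeasurableSet K') {r C δ : ℝ} (hr : 0 < r) (hC : 0 ≤ C) (hδ : 0 < δ)
    (hKK' : ∀ x ∈ K, ∀ z : EuclideanSpace ℝ (Fin n), ‖z‖ < δ → x + z ∈ K')
    (hA : ∫⁻ x in K', ‖V x‖ₑ ^ r < ∞)
    (hz : ∀ z : EuclideanSpace ℝ (Fin n), ‖z‖ < δ →
      ∫⁻ x in K, ‖V (x + z) - V x‖ₑ ^ (2 : ℝ) ≤ ENNReal.ofReal (C * ‖z‖ ^ σ)) :
    ∃ D t₀ : ℝ, 0 ≤ D ∧ 0 < t₀ ∧ ∀ t, t₀ ≤ t → volume ({x | t < ‖V x‖} ∩ K) ≤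
      ENNReal.ofReal (D * t ^ (-(2 + σ * r / n))) := by
  have hn' : (0 : ℝ) < n := by exact_mod_cast hn
  have : NeZero n := ⟨hn.ne'⟩
  set A := (∫⁻ x in K', ‖V x‖ₑ ^ r).toReal with hAdef
  have hA0 : 0 ≤ A := ENNReal.toReal_nonneg
  set ω := (volume (ball (0 : EuclideanSpace ℝ (Fin n)) 1)).toReal with hω
  have hω0 : 0 < ω := ENNReal.toReal_pos (measure_ball_pos _ _ one_pos).ne' measure_ball_lt_top.ne
  set c := 2 * 2 ^ r * (A + 1) / ω with hc
  have hc0 : 0 < c := by positivity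
  -- the radius
  have hlim : Filter.Tendsto (fun t : ℝ => (c * t ^ (-r)) ^ (1 / (n : ℝ))) Filter.atTop (nhds 0) := by
    have h1 : Filter.Tendsto (fun t : ℝ => c * t ^ (-r)) Filter.atTop (nhds 0) := by
      simpa using (tendsto_rpow_neg_atTop hr).const_mul c
    have h2 := h1.rpow_const (p := 1 / (n : ℝ)) (Or.inr (by positivity))
    rwa [Real.zero_rpow (by positivity)] at h2
  obtain ⟨t₁, ht₁⟩ := Filter.eventually_atTop.1 (hlim.eventually (gt_mem_nhds hδ))
  refine ⟨8 * C * c ^ (σ / n), max t₁ 1, by positivity, by positivity, fun t ht => ?_⟩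
  have ht0 : 0 < t := lt_of_lt_of_le one_pos ((le_max_right _ _).trans ht)
  have htδ := ht₁ t ((le_max_left _ _).trans ht)
  set ρ := (c * t ^ (-r)) ^ (1 / (n : ℝ)) with hρ
  have htr : 0 < t ^ (-r) := Real.rpow_pos_of_pos ht0 _
  have hρ0 : 0 < ρ := Real.rpow_pos_of_pos (by positivity) _
  have hρn : ρ ^ n = c * t ^ (-r) := by
    rw [hρ, ← Real.rpow_natCast, ← Real.rpow_mul (by positivity)]
    rw [one_div, inv_mul_cancel₀ hn'.ne', Real.rpow_one]
  have hvol : volume (ball (0 : EuclideanSpace ℝ (Fin n)) ρ) = ENNReal.ofReal (ρ ^ n * ω) := by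
    rw [Measure.addHaar_ball _ _ hρ0.le, ENNReal.ofReal_mul (by positivity), hω,
      ENNReal.ofReal_toReal measure_ball_lt_top.ne]
    simp
  have key := good_est hV hK hK' (ρ := ρ) (r := r) (L := ENNReal.ofReal (t / 2))
    (T := ENNReal.ofReal (C * ρ ^ σ)) hρ0 hr (by simp [ht0]) ENNReal.ofReal_ne_top
    (fun x hx z hz' => hKK' x hx z ((mem_ball_zero_iff.1 hz').trans htδ)) ?_ ?_
  · have e1 : {x | 2 * ENNReal.ofReal (t / 2) < ‖V x‖ₑ} = {x | t < ‖V x‖} := by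
      ext x
      simp only [Set.mem_ofPred_eq]
      rw [← ofReal_norm, two_mul_ofReal, ENNReal.ofReal_lt_ofReal_iff_of_nonneg (by positivity)]
      rw [mul_div_cancel₀ _ (by norm_num)]
    rw [e1, ENNReal.ofReal_rpow_of_pos (by positivity), two_mul_ofReal] at key
    have h4 : 0 < (t / 2) ^ (2 : ℝ) := by positivity
    rw [mul_comm] at key
    have k2 := (ENNReal.le_div_iff_mul_le (Or.inl (by simpa using ht0.ne'))
      (Or.inl ENNReal.ofReal_ne_top)).2 key
    rw [← ENNReal.ofReal_div_of_pos h4] at k2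
    refine k2.trans (ENNReal.ofReal_le_ofReal (le_of_eq ?_))
    have e2 : ρ ^ σ = c ^ (σ / n) * t ^ (-(σ * r / n)) := by
      rw [hρ, ← Real.rpow_mul (by positivity), Real.mul_rpow hc0.le htr.le, ← Real.rpow_mul ht0.le]
      congr 2 <;> field_simp
    have e3 : t ^ (-(2 + σ * r / n)) = t ^ (-(σ * r / n)) / t ^ 2 := by
      rw [neg_add, Real.rpow_add ht0, Real.rpow_neg ht0.le, Real.rpow_two]; field_simp
    rw [e2, e3, Real.rpow_two]
    field_simp
    ring
  · rw [hvol, ENNReal.ofReal_rpow_of_pos (by positivity), ← ENNReal.ofReal_mul (by positivity),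
      ← ENNReal.ofReal_toReal hA.ne, two_mul_ofReal]
    apply ENNReal.ofReal_le_ofReal
    rw [hρn, hc, Real.div_rpow ht0.le (by norm_num), Real.rpow_neg ht0.le, ← hAdef]
    have : 0 < t ^ r := Real.rpow_pos_of_pos ht0 _
    have e : t ^ r / 2 ^ r * (2 * 2 ^ r * (A + 1) / ω * (t ^ r)⁻¹ * ω) = 2 * (A + 1) := by
      field_simp
    rw [e]; linarith
  · intro z hz'
    have := mem_ball_zero_iff.1 hz'
    refine (hz z (this.trans htδ)).trans (ENNReal.ofReal_le_ofReal ?_)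
    gcongr

lemma layer {n : ℕ} {g : EuclideanSpace ℝ (Fin n) → ℝ} (hg : Measurable g) (hg0 : ∀ x, 0 ≤ g x)
    {K : Set (EuclideanSpace ℝ (Fin n))} (hK : IsCompact K) {D t₀ β r' : ℝ} (hD : 0 ≤ D)
    (ht₀ : 0 < t₀) (hr' : 0 < r') (hβ : r' < β)
    (h : ∀ t, t₀ ≤ t → volume ({x | t < g x} ∩ K) ≤ ENNReal.ofReal (D * t ^ (-β))) :
    ∫⁻ x in K, ENNReal.ofReal (g x ^ r') < ∞ := by
  rw [lintegral_rpow_eq_lintegral_meas_lt_mul _ (Filter.Eventually.of_forall hg0)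
    hg.aemeasurable hr']
  refine ENNReal.mul_lt_top ENNReal.ofReal_lt_top ?_
  have hI : Set.Ioi (0 : ℝ) = Set.Ioc 0 t₀ ∪ Set.Ioi t₀ := (Set.Ioc_union_Ioi_eq_Ioi ht₀.le).symm
  rw [hI]
  refine (lintegral_union_le _ _ _).trans_lt (ENNReal.add_lt_top.2 ⟨?_, ?_⟩)
  · have hi : IntegrableOn (fun t : ℝ => t ^ (r' - 1)) (Set.Ioc 0 t₀) volume :=
      (intervalIntegrable_iff_integrableOn_Ioc_of_le ht₀.le).1
        (intervalIntegral.intervalIntegrable_rpow' (by linarith))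
    calc _ ≤ ∫⁻ t in Set.Ioc 0 t₀, volume K * ENNReal.ofReal (t ^ (r' - 1)) := by
          refine lintegral_mono fun t => ?_
          refine mul_le_mul_left ?_ _
          rw [Measure.restrict_apply (measurableSet_lt measurable_const hg)]
          exact measure_mono Set.inter_subset_right
      _ = volume K * ∫⁻ t in Set.Ioc 0 t₀, ENNReal.ofReal (t ^ (r' - 1)) :=
          lintegral_const_mul' _ _ hK.measure_lt_top.ne
      _ < ∞ := ENNReal.mul_lt_top hK.measure_lt_top hi.setLIntegral_lt_top
  · have hi : IntegrableOn (fun t : ℝ => t ^ (-β + (r' - 1))) (Set.Ioi t₀) volume :=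
      integrableOn_Ioi_rpow_of_lt (by linarith) ht₀
    calc _ ≤ ∫⁻ t in Set.Ioi t₀, ENNReal.ofReal D * ENNReal.ofReal (t ^ (-β + (r' - 1))) := by
          refine setLIntegral_mono' measurableSet_Ioi fun t ht => ?_
          rw [Measure.restrict_apply (measurableSet_lt measurable_const hg)]
          have ht0 : 0 < t := ht₀.trans ht
          refine (mul_le_mul_left (h t (le_of_lt ht)) _).trans (le_of_eq ?_)
          rw [Real.rpow_add ht0, ENNReal.ofReal_mul hD, ENNReal.ofReal_mul (by positivity), mul_assoc]
      _ = ENNReal.ofReal D * ∫⁻ t in Set.Ioi t₀, ENNReal.ofReal (t ^ (-β + (r' - 1))) :=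
          lintegral_const_mul' _ _ ENNReal.ofReal_ne_top
      _ < ∞ := ENNReal.mul_lt_top ENNReal.ofReal_lt_top hi.setLIntegral_lt_top

lemma enorm_rpow_eq {W : Type*} [NormedAddCommGroup W] (w : W) {r : ℝ} (hr : 0 ≤ r) :
    ‖w‖ₑ ^ r = ENNReal.ofReal (‖w‖ ^ r) := by
  rw [← ofReal_norm, ENNReal.ofReal_rpow_of_nonneg (norm_nonneg _) hr]

lemma step {n : ℕ} (hn : 0 < n) {σ : ℝ} (hσ : 0 < σ) {Ω : Set (EuclideanSpace ℝ (Fin n))}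
    (hΩ : IsOpen Ω) {V : EuclideanSpace ℝ (Fin n) → EuclideanSpace ℝ (Fin n)} (hV : Measurable V)
    (hB : ∀ K, IsCompact K → K ⊆ Ω → ∃ C δ : ℝ, 0 ≤ C ∧ 0 < δ ∧ ∀ z : EuclideanSpace ℝ (Fin n),
      ‖z‖ < δ → ∫⁻ x in K, ‖V (x + z) - V x‖ₑ ^ (2 : ℝ) ≤
        ENNReal.ofReal (C * ‖z‖ ^ σ))
    {r r' : ℝ} (hr : 0 < r) (hr' : 0 < r') (hrr : r' < 2 + σ * r / n)
    (hA : ∀ K, IsCompact K → K ⊆ Ω → ∫⁻ x in K, ‖V x‖ₑ ^ r < ∞) :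
    ∀ K, IsCompact K → K ⊆ Ω → ∫⁻ x in K, ‖V x‖ₑ ^ r' < ∞ := by
  intro K hK hKΩ
  obtain ⟨δ₀, hδ₀, hK'⟩ := hK.exists_cthickening_subset_open hΩ hKΩ
  have hK'c : IsCompact (cthickening δ₀ K) := hK.cthickening
  obtain ⟨C, δ, hC, hδ, h1⟩ := hB K hK hKΩ
  obtain ⟨D, t₀, hD, ht₀, h2⟩ := weak_type hn hσ hV hK.measurableSet hK'c.measurableSet hr hC
    (δ := min δ δ₀) (by positivity)
    (fun x hx z hz => mem_cthick hx ((lt_min_iff.1 hz).2.le)) (hA _ hK'c hK')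
    (fun z hz => h1 z (lt_min_iff.1 hz).1)
  simp_rw [enorm_rpow_eq _ hr'.le]
  exact layer hV.norm (fun x => norm_nonneg _) hK hD ht₀ hr' hrr h2

lemma lower_exp {n : ℕ} {V : EuclideanSpace ℝ (Fin n) → EuclideanSpace ℝ (Fin n)}
    {K : Set (EuclideanSpace ℝ (Fin n))} (hK : IsCompact K) {r r' : ℝ} (hr : 0 ≤ r) (hrr : r ≤ r')
    (h : ∫⁻ x in K, ‖V x‖ₑ ^ r' < ∞) : ∫⁻ x in K, ‖V x‖ₑ ^ r < ∞ := by
  calc _ ≤ ∫⁻ x in K, (1 + ‖V x‖ₑ ^ r') := by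
        refine lintegral_mono fun x => ?_
        rcases le_total (‖V x‖ₑ) 1 with h1 | h1
        · exact (ENNReal.rpow_le_one h1 hr).trans le_self_add
        · exact (ENNReal.rpow_le_rpow_of_exponent_le h1 hrr).trans le_add_self
    _ = volume K + ∫⁻ x in K, ‖V x‖ₑ ^ r' := by
        rw [lintegral_add_left measurable_const]; simp
    _ < ∞ := ENNReal.add_lt_top.2 ⟨hK.measure_lt_top, h⟩

lemma bootstrap {n : ℕ} (hn : 2 ≤ n) {σ : ℝ} (hσ : 0 < σ) (hσ2 : σ < 2)
    {Ω : Set (EuclideanSpace ℝ (Fin n))}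
    (hΩ : IsOpen Ω) {V : EuclideanSpace ℝ (Fin n) → EuclideanSpace ℝ (Fin n)} (hV : Measurable V)
    (hB : ∀ K, IsCompact K → K ⊆ Ω → ∃ C δ : ℝ, 0 ≤ C ∧ 0 < δ ∧ ∀ z : EuclideanSpace ℝ (Fin n),
      ‖z‖ < δ → ∫⁻ x in K, ‖V (x + z) - V x‖ₑ ^ (2 : ℝ) ≤
        ENNReal.ofReal (C * ‖z‖ ^ σ))
    (hA : ∀ K, IsCompact K → K ⊆ Ω → ∫⁻ x in K, ‖V x‖ₑ ^ (2 : ℝ) < ∞)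
    {r : ℝ} (hr : 0 < r) (hrr : r < 2 * n / (n - σ)) :
    ∀ K, IsCompact K → K ⊆ Ω → ∫⁻ x in K, ‖V x‖ₑ ^ r < ∞ := by
  have hn' : (2 : ℝ) ≤ n := by exact_mod_cast hn
  set θ := σ / n with hθ
  have hθ0 : 0 < θ := by positivity
  have hθ1 : θ < 1 := by rw [hθ, div_lt_one (by linarith)]; linarith
  have hr1 : r * (1 - θ) < 2 := by
    have : r * (n - σ) < 2 * n := (lt_div_iff₀ (by linarith)).1 hrr
    have e : 1 - θ = (n - σ) / n := by rw [hθ]; field_simp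
    rw [e, ← mul_div_assoc, div_lt_iff₀ (by linarith)]; exact this
  by_cases hr2 : r ≤ 2
  · exact fun K hK hKΩ => lower_exp hK hr.le hr2 (hA K hK hKΩ)
  push Not at hr2
  -- choose F strictly between r and 2/(1-θ)
  obtain ⟨F, hF1, hF2⟩ : ∃ F, r < F ∧ F * (1 - θ) < 2 := by
    refine ⟨(r + 2 / (1 - θ)) / 2, ?_, ?_⟩
    · have : r < 2 / (1 - θ) := (lt_div_iff₀ (by linarith)).2 hr1
      linarith
    · have : (r + 2 / (1 - θ)) / 2 * (1 - θ) = (r * (1 - θ) + 2) / 2 := by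
        have : 1 - θ ≠ 0 := by linarith
        field_simp
      rw [this]; linarith
  have hseq : ∀ j : ℕ, 0 < F - θ ^ j * (F - 2) ∧
      ∀ K, IsCompact K → K ⊆ Ω → ∫⁻ x in K, ‖V x‖ₑ ^ (F - θ ^ j * (F - 2)) < ∞ := by
    intro j
    induction j with
    | zero =>
      refine ⟨by simp, fun K hK hKΩ => ?_⟩
      have : F - θ ^ 0 * (F - 2) = 2 := by ring
      rw [this]; exact hA K hK hKΩ
    | succ j ih =>
      have hpos : 0 < F - θ ^ (j + 1) * (F - 2) := by
        have : θ ^ (j + 1) ≤ 1 := pow_le_one₀ hθ0.le hθ1.le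
        nlinarith
      refine ⟨hpos, step (by omega) hσ hΩ hV hB ih.1 hpos ?_ ih.2⟩
      have e : σ * (F - θ ^ j * (F - 2)) / n = θ * (F - θ ^ j * (F - 2)) := by rw [hθ]; ring
      rw [e, pow_succ]
      nlinarith
  obtain ⟨j, hj⟩ : ∃ j : ℕ, r ≤ F - θ ^ j * (F - 2) := by
    have hl := (tendsto_pow_atTop_nhds_zero_of_lt_one hθ0.le hθ1).mul_const (F - 2)
    rw [zero_mul] at hl
    obtain ⟨j, hj⟩ := (hl.eventually (gt_mem_nhds (show 0 < F - r by linarith))).exists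
    exact ⟨j, by linarith⟩
  exact fun K hK hKΩ => lower_exp hK hr.le hj ((hseq j).2 K hK hKΩ)

open MeasureTheory Metric
open scoped RealInnerProductSpace ENNReal
set_option linter.unusedVariables false

lemma core {n : ℕ} (hn : 2 ≤ n) {p q α : ℝ} (hpq : p.HolderConjugate q) (hq : 2 ≤ q)
    (hα0 : 0 < α) (hα : α < 1)
    {Ω : Set (EuclideanSpace ℝ (Fin n))}
    {u : EuclideanSpace ℝ (Fin n) → ℝ}
    {Du : EuclideanSpace ℝ (Fin n) → EuclideanSpace ℝ (Fin n)}
    {f : EuclideanSpace ℝ (Fin n) → ℝ} (hum : Measurable u) (hDum : Measurable Du)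
    (hfm : Measurable f) (hu : MemW1Loc n q Ω u Du)
    (hsol : IsLocalWeakSolution n q Ω Du f) (hΩ : IsOpen Ω)
    (hf : ∀ K, IsCompact K → K ⊆ Ω → MemLp f (ENNReal.ofReal p) (volume.restrict K))
    (hfB : ∀ K, IsCompact K → K ⊆ Ω → ∃ C δ : ℝ, 0 ≤ C ∧ 0 < δ ∧ ∀ (s : Fin n) (t : ℝ), t ≠ 0 →
      |t| < δ → ∫⁻ x in K, ‖f (x + t • unitVec n s) - f x‖ₑ ^ p ≤
        ENNReal.ofReal (C * |t| ^ (α * p)))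
    {r : ℝ} (hr : 0 < r) (hrr : r < 2 * n / (n - α - 1)) :
    ∀ K, IsCompact K → K ⊆ Ω → ∫⁻ x in K, ‖Hmap n (q / 2) (Du x)‖ₑ ^ r < ∞ := by
  have hVm : Measurable (fun x => Hmap n (q / 2) (Du x)) := (Hmap_measurable (q / 2)).comp hDum
  have h1 := V_besov hn hpq hq hα0 hα hum hDum hfm hu hsol hΩ hf hfB
  have h2 := chain_all (σ := 1 + α) (by linarith) hΩ hVm h1
  refine bootstrap hn (σ := 1 + α) (by linarith) (by linarith) hΩ hVm h2 ?_ hr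
    (by rw [show (n : ℝ) - (1 + α) = n - α - 1 by ring]; exact hrr)
  intro K hK hKΩ
  have hD := (memLp_ofReal_iff _ _ (by linarith) hDum.aestronglyMeasurable).1 (hu.1 K hK hKΩ).2
  refine lt_of_le_of_lt (lintegral_mono fun x => ?_) hD
  rw [enorm_rpow_eq _ (by norm_num), enorm_rpow_eq _ (by linarith)]
  apply ENNReal.ofReal_le_ofReal
  rw [Hmap_norm _ (by linarith), ← Real.rpow_mul (le_max_right _ _),
    show q / 2 * 2 = q by ring]
  exact Real.rpow_le_rpow (le_max_right _ _) (max_le (by linarith) (norm_nonneg _)) (by linarith)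

lemma aesm_of_local {n : ℕ} {W : Type*} [TopologicalSpace W] [TopologicalSpace.PseudoMetrizableSpace W]
    {Ω : Set (EuclideanSpace ℝ (Fin n))}
    {g : EuclideanSpace ℝ (Fin n) → W}
    (h : ∀ x ∈ Ω, ∃ r > 0, AEStronglyMeasurable g (volume.restrict (ball x r))) :
    AEStronglyMeasurable g (volume.restrict Ω) := by
  choose! r hr hg using h
  obtain ⟨T, hT, hTU⟩ := TopologicalSpace.isOpen_iUnion_countable
    (fun x : Ω => ball (x : EuclideanSpace ℝ (Fin n)) (r x)) (fun x => isOpen_ball)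
  have : AEStronglyMeasurable g (volume.restrict (⋃ x ∈ T, ball (x : EuclideanSpace ℝ (Fin n)) (r x))) := by
    have hc : Countable T := hT.to_subtype
    rw [Set.biUnion_eq_iUnion, aestronglyMeasurable_iUnion_iff]
    exact fun x => hg _ x.1.2
  refine this.mono_measure (Measure.restrict_mono ?_ le_rfl)
  rw [hTU]
  intro x hx
  exact Set.mem_iUnion.2 ⟨⟨x, hx⟩, mem_ball_self (hr x hx)⟩

lemma ae_shift {n : ℕ} {Ω S : Set (EuclideanSpace ℝ (Fin n))} (hΩ : IsOpen Ω)
    (hS : MeasurableSet S) {f g : EuclideanSpace ℝ (Fin n) → ℝ} (hfg : f =ᵐ[volume.restrict Ω] g)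
    (h : EuclideanSpace ℝ (Fin n)) (h1 : S ⊆ Ω) (h2 : ∀ x ∈ S, x + h ∈ Ω) :
    (fun x => f (x + h) - f x) =ᵐ[volume.restrict S] (fun x => g (x + h) - g x) := by
  have a1 : ∀ᵐ y ∂(volume : Measure (EuclideanSpace ℝ (Fin n))), y ∈ Ω → f y = g y :=
    (ae_restrict_iff' hΩ.measurableSet).1 hfg
  have a2 := (measurePreserving_add_right volume h).quasiMeasurePreserving.ae a1
  refine (ae_restrict_iff' hS).2 ?_
  filter_upwards [a1, a2] with x b1 b2 hx
  rw [b1 (h1 hx), b2 (h2 x hx)]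

lemma besov_meas {n : ℕ} {p α : ℝ} (hp : 1 < p) {Ω : Set (EuclideanSpace ℝ (Fin n))}
    (hΩ : IsOpen Ω) {f g : EuclideanSpace ℝ (Fin n) → ℝ} (hg : Measurable g)
    (hfg : f =ᵐ[volume.restrict Ω] g) (hf : MemBesovLoc n p α Ω f) :
    (∀ K, IsCompact K → K ⊆ Ω → MemLp g (ENNReal.ofReal p) (volume.restrict K)) ∧
    (∀ K, IsCompact K → K ⊆ Ω → ∃ C δ : ℝ, 0 ≤ C ∧ 0 < δ ∧ ∀ (s : Fin n) (t : ℝ), t ≠ 0 →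
      |t| < δ → ∫⁻ x in K, ‖g (x + t • unitVec n s) - g x‖ₑ ^ p ≤
        ENNReal.ofReal (C * |t| ^ (α * p))) := by
  have hp0 : 0 < p := by linarith
  have hball : ∀ z r, 0 < r → closedBall z r ⊆ Ω → ∫⁻ x in ball z r, ‖g x‖ₑ ^ p < ∞ := by
    intro z r hr hz
    have h1 := (hf z r hr hz).1
    have h2 : (fun x => |f x| ^ p) =ᵐ[volume.restrict (ball z r)] fun x => |g x| ^ p := by
      filter_upwards [ae_restrict_of_ae_restrict_of_subset (ball_subset_closedBall.trans hz) hfg]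
        with x hx
      rw [hx]
    have h3 : IntegrableOn (fun x => |g x| ^ p) (ball z r) volume := h1.congr h2
    have h4 := h3.setLIntegral_lt_top
    refine lt_of_le_of_lt (lintegral_mono fun x => ?_) h4
    rw [enorm_rpow_eq _ hp0.le, Real.norm_eq_abs]
  have hloc : ∀ x ∈ Ω, ∃ r > 0, closedBall x (2 * r) ⊆ Ω := by
    intro x hx
    obtain ⟨ε, hε, h⟩ := Metric.isOpen_iff.1 hΩ x hx
    exact ⟨ε / 4, by positivity, (closedBall_subset_ball (by linarith)).trans h⟩
  constructor
  · intro K hK hKΩ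
    rw [memLp_ofReal_iff _ _ hp0 hg.aestronglyMeasurable]
    refine hK.induction_on (p := fun K => ∫⁻ x in K, ‖g x‖ₑ ^ p < ∞) (by simp)
      (fun s t hst ht => (lintegral_mono_set hst).trans_lt ht)
      (fun s t hs ht => (lintegral_union_le _ _ _).trans_lt (ENNReal.add_lt_top.2 ⟨hs, ht⟩))
      (fun x hx => ?_)
    obtain ⟨r, hr, hrx⟩ := hloc x (hKΩ hx)
    exact ⟨ball x (2 * r), mem_nhdsWithin_of_mem_nhds (ball_mem_nhds _ (by positivity)),
      hball x _ (by positivity) hrx⟩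
  · intro K hK hKΩ
    refine hK.induction_on (p := fun K => ∃ C δ : ℝ, 0 ≤ C ∧ 0 < δ ∧ ∀ (s : Fin n) (t : ℝ), t ≠ 0 →
      |t| < δ → ∫⁻ x in K, ‖g (x + t • unitVec n s) - g x‖ₑ ^ p ≤
        ENNReal.ofReal (C * |t| ^ (α * p))) ⟨0, 1, le_rfl, one_pos, by simp⟩ ?_ ?_ ?_
    · rintro s t hst ⟨C, δ, hC, hδ, h⟩
      exact ⟨C, δ, hC, hδ, fun i τ h1 h2 => (lintegral_mono_set hst).trans (h i τ h1 h2)⟩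
    · rintro s t ⟨C, δ, hC, hδ, h⟩ ⟨C', δ', hC', hδ', h'⟩
      refine ⟨C + C', min δ δ', by positivity, by positivity, fun i τ h1 h2 => ?_⟩
      refine (lintegral_union_le _ _ _).trans ?_
      rw [add_mul, ENNReal.ofReal_add (by positivity) (by positivity)]
      exact add_le_add (h i τ h1 (lt_min_iff.1 h2).1) (h' i τ h1 (lt_min_iff.1 h2).2)
    · intro x hx
      obtain ⟨r, hr, hrx⟩ := hloc x (hKΩ hx)
      refine ⟨ball x r, mem_nhdsWithin_of_mem_nhds (ball_mem_nhds _ hr), ?_⟩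
      have hrx1 : closedBall x r ⊆ Ω := (closedBall_subset_closedBall (by linarith)).trans hrx
      obtain ⟨M, hM⟩ := (hf x r hr hrx1).2
      have hM0 : 0 ≤ max M 0 := le_max_right _ _
      refine ⟨(max M 0) ^ p, r, by positivity, hr, fun s t ht htr => ?_⟩
      have hsub : ball x r ⊆ ball x (2 * r) := ball_subset_ball (by linarith)
      have hsh : ∀ y ∈ ball x r, y + t • unitVec n s ∈ ball x (2 * r) := by
        intro y hy
        rw [mem_ball, dist_eq_norm] at hy ⊢
        have e : ‖t • unitVec n s‖ = |t| := by
          rw [norm_smul, norm_unitVec, mul_one, Real.norm_eq_abs]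
        calc ‖y + t • unitVec n s - x‖ = ‖(y - x) + t • unitVec n s‖ := by congr 1; abel
          _ ≤ ‖y - x‖ + ‖t • unitVec n s‖ := norm_add_le _ _
          _ < 2 * r := by rw [e]; linarith
      have hgL : MemLp g (ENNReal.ofReal p) (volume.restrict (ball x (2 * r))) :=
        (memLp_ofReal_iff _ _ hp0 hg.aestronglyMeasurable).2 (hball x _ (by positivity) hrx)
      have hτ := memLp_shift_sub hg hp0 measurableSet_ball measurableSet_ball hgL
        (t • unitVec n s) hsub hsh
      have hfin := (memLp_ofReal_iff _ _ hp0 hτ.1).1 hτ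
      simp_rw [enorm_rpow_eq _ hp0.le, Real.norm_eq_abs] at hfin ⊢
      have hIntg : Integrable (fun y => |g (y + t • unitVec n s) - g y| ^ p)
          (volume.restrict (ball x r)) := by
        refine ⟨(by fun_prop : Measurable _).aestronglyMeasurable, ?_⟩
        rw [hasFiniteIntegral_iff_ofReal (Filter.Eventually.of_forall fun y => by positivity)]
        exact hfin
      rw [← ofReal_integral_eq_lintegral_ofReal hIntg (Filter.Eventually.of_forall fun y => by positivity)]
      apply ENNReal.ofReal_le_ofReal
      have hmem := hM ⟨s, t, ht, rfl⟩
      have hae := ae_shift hΩ measurableSet_ball hfg (t • unitVec n s)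
        (ball_subset_closedBall.trans hrx1) (fun y hy => hrx (ball_subset_closedBall (hsh y hy)))
      have e1 : ∫ y in ball x r, |f (y + t • unitVec n s) - f y| ^ p / |t| ^ (α * p) =
          (∫ y in ball x r, |g (y + t • unitVec n s) - g y| ^ p) / |t| ^ (α * p) := by
        rw [integral_div]
        congr 1
        refine integral_congr_ae ?_
        filter_upwards [hae] with y hy
        rw [hy]
      rw [e1] at hmem
      set I := ∫ y in ball x r, |g (y + t • unitVec n s) - g y| ^ p with hI
      have hI0 : 0 ≤ I := integral_nonneg fun y => by positivity
      have ht0 : 0 < |t| ^ (α * p) := Real.rpow_pos_of_pos (abs_pos.2 ht) _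
      have h5 : I / |t| ^ (α * p) ≤ (max M 0) ^ p := by
        have := Real.rpow_le_rpow (by positivity) (hmem.trans (le_max_left M 0)) hp0.le
        rwa [← Real.rpow_mul (by positivity), one_div, inv_mul_cancel₀ hp0.ne', Real.rpow_one] at this
      exact (div_le_iff₀ ht0).1 h5

open MeasureTheory Metric
open scoped RealInnerProductSpace ENNReal
set_option linter.unusedVariables false

lemma gradient_add_c1 {n : ℕ} {φ ψ : EuclideanSpace ℝ (Fin n) → ℝ} (hφ : ContDiff ℝ 1 φ)
    (hψ : ContDiff ℝ 1 ψ) (x : EuclideanSpace ℝ (Fin n)) :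
    gradient (φ + ψ) x = gradient φ x + gradient ψ x := by
  unfold gradient
  rw [fderiv_add (hφ.differentiable (by norm_num) x) (hψ.differentiable (by norm_num) x), map_add]

lemma pairing_integrable {n : ℕ} {p q : ℝ} (hpq : p.HolderConjugate q)
    {Ω : Set (EuclideanSpace ℝ (Fin n))}
    {Du : EuclideanSpace ℝ (Fin n) → EuclideanSpace ℝ (Fin n)} (hDum : Measurable Du)
    (hDu : ∀ K, IsCompact K → K ⊆ Ω → MemLp Du (ENNReal.ofReal q) (volume.restrict K))
    {φ : EuclideanSpace ℝ (Fin n) → ℝ} (hφ : ContDiff ℝ 1 φ) (hc : HasCompactSupport φ)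
    (hs : tsupport φ ⊆ Ω) :
    Integrable (fun x => ⟪Hmap n (q - 1) (Du x), gradient φ x⟫) (volume.restrict Ω) := by
  have hK : IsCompact (tsupport φ) := hc
  have hgc := gradient_continuous hφ
  have hsupp : ∀ x, x ∉ tsupport φ → gradient φ x = 0 := by
    intro x hx
    unfold gradient
    rw [fderiv_of_notMem_tsupport ℝ hx, map_zero]
  have hfin : IsFiniteMeasure (volume.restrict (tsupport φ)) := ⟨by
    rw [Measure.restrict_apply_univ]; exact hK.measure_lt_top⟩
  have hG : Integrable (fun x => Hmap n (q - 1) (Du x)) (volume.restrict (tsupport φ)) := by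
    refine (G_memLp hpq hDum (hDu _ hK hs)).integrable ?_
    rw [← ENNReal.ofReal_one]
    exact ENNReal.ofReal_le_ofReal hpq.lt.le
  have hGm : Measurable (fun x => Hmap n (q - 1) (Du x)) := (Hmap_measurable (q - 1)).comp hDum
  have hm : Measurable (fun x => ⟪Hmap n (q - 1) (Du x), gradient φ x⟫) :=
    hGm.inner hgc.measurable
  obtain ⟨C, hC⟩ := hK.exists_bound_of_continuousOn hgc.continuousOn
  have h1 : IntegrableOn (fun x => ⟪Hmap n (q - 1) (Du x), gradient φ x⟫) (tsupport φ) volume := by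
    refine Integrable.mono' (hG.norm.const_mul C) hm.aestronglyMeasurable ?_
    refine (ae_restrict_iff' hK.measurableSet).2 (Filter.Eventually.of_forall fun x hx => ?_)
    refine (norm_inner_le_norm _ _).trans ?_
    rw [mul_comm]
    exact mul_le_mul_of_nonneg_right (hC x hx) (norm_nonneg _)
  have h2 := (integrableOn_iff_integrable_of_support_subset (s := tsupport φ) (fun x hx => by
    by_contra h
    exact hx (by simp [hsupp x h]))).1 h1
  exact h2.integrableOn

lemma not_integrable_bad {n : ℕ} {Ω : Set (EuclideanSpace ℝ (Fin n))} (hΩ : IsOpen Ω)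
    {f : EuclideanSpace ℝ (Fin n) → ℝ} {x₀ : EuclideanSpace ℝ (Fin n)} (hx₀ : x₀ ∈ Ω)
    (hbad : ∀ r > 0, ¬ AEStronglyMeasurable f (volume.restrict (ball x₀ r)))
    {φ : EuclideanSpace ℝ (Fin n) → ℝ} (hφ : Continuous φ) (h0 : φ x₀ ≠ 0) :
    ∫ x in Ω, f x * φ x = 0 := by
  refine integral_undef fun hIntg => ?_
  have hU : IsOpen (Ω ∩ {x | φ x ≠ 0}) := hΩ.inter (isOpen_ne_fun hφ continuous_const)
  obtain ⟨r, hr, hrU⟩ := Metric.isOpen_iff.1 hU x₀ ⟨hx₀, h0⟩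
  refine hbad r hr ?_
  have h1 : AEStronglyMeasurable (fun x => f x * φ x) (volume.restrict (ball x₀ r)) :=
    hIntg.1.mono_measure (Measure.restrict_mono (fun x hx => (hrU hx).1) le_rfl)
  have h2 : AEStronglyMeasurable (fun x => (φ x)⁻¹) (volume.restrict (ball x₀ r)) :=
    hφ.measurable.inv.aestronglyMeasurable
  refine (h1.mul h2).congr ?_
  refine (ae_restrict_iff' measurableSet_ball).2 (Filter.Eventually.of_forall fun x hx => ?_)
  have : φ x ≠ 0 := (hrU hx).2
  simp [mul_assoc, mul_inv_cancel₀ this]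

lemma get_f {n : ℕ} {p q α : ℝ} (hpq : p.HolderConjugate q)
    {Ω : Set (EuclideanSpace ℝ (Fin n))} (hΩ : IsOpen Ω)
    {Du : EuclideanSpace ℝ (Fin n) → EuclideanSpace ℝ (Fin n)} (hDum : Measurable Du)
    (hDu : ∀ K, IsCompact K → K ⊆ Ω → MemLp Du (ENNReal.ofReal q) (volume.restrict K))
    {f : EuclideanSpace ℝ (Fin n) → ℝ} (hf : MemBesovLoc n p α Ω f)
    (hsol : IsLocalWeakSolution n q Ω Du f) :
    ∃ g : EuclideanSpace ℝ (Fin n) → ℝ, Measurable g ∧ IsLocalWeakSolution n q Ω Du g ∧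
    (∀ K, IsCompact K → K ⊆ Ω → MemLp g (ENNReal.ofReal p) (volume.restrict K)) ∧
    (∀ K, IsCompact K → K ⊆ Ω → ∃ C δ : ℝ, 0 ≤ C ∧ 0 < δ ∧ ∀ (s : Fin n) (t : ℝ), t ≠ 0 →
      |t| < δ → ∫⁻ x in K, ‖g (x + t • unitVec n s) - g x‖ₑ ^ p ≤
        ENNReal.ofReal (C * |t| ^ (α * p))) := by
  have hp0 : 0 < p := hpq.pos
  by_cases hgood : ∀ x ∈ Ω, ∃ r > 0, AEStronglyMeasurable f (volume.restrict (ball x r))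
  · have hm := aesm_of_local hgood
    have hgm : Measurable (hm.mk f) := hm.stronglyMeasurable_mk.measurable
    have hfg := hm.ae_eq_mk
    obtain ⟨h1, h2⟩ := besov_meas hpq.lt hΩ hgm hfg hf
    refine ⟨hm.mk f, hgm, fun φ a b c => ?_, h1, h2⟩
    rw [hsol φ a b c]
    refine integral_congr_ae ?_
    filter_upwards [hfg] with x hx
    rw [hx]
  · push Not at hgood
    obtain ⟨x₀, hx₀, hbad⟩ := hgood
    refine ⟨fun _ => 0, measurable_const, ?_, fun K _ _ => MemLp.zero,
      fun K _ _ => ⟨0, 1, le_rfl, one_pos, fun s t _ _ => by simp [hp0]⟩⟩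
    have hne : ∀ φ : EuclideanSpace ℝ (Fin n) → ℝ, ContDiff ℝ 1 φ → HasCompactSupport φ →
        tsupport φ ⊆ Ω → φ x₀ ≠ 0 →
        ∫ x in Ω, ⟪Hmap n (q - 1) (Du x), gradient φ x⟫ = 0 := by
      intro φ a b c h0
      rw [hsol φ a b c]
      exact not_integrable_bad hΩ hx₀ hbad a.continuous h0
    intro φ a b c
    simp only [zero_mul, integral_zero]
    by_cases h0 : φ x₀ = 0
    · obtain ⟨ψ, s1, s2, s3, -, s5⟩ := exists_contDiff_tsupport_subset (n := 1) (hΩ.mem_nhds hx₀)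
      have s3' : ContDiff ℝ 1 ψ := by exact_mod_cast s3
      have e1 := hne ψ s3' s2 s1 (by rw [s5]; norm_num)
      have e2 := hne (φ + ψ) (a.add s3') (b.add s2)
        ((tsupport_add φ ψ).trans (Set.union_subset c s1)) (by simp [h0, s5])
      simp_rw [gradient_add_c1 a s3', inner_add_right] at e2
      rw [integral_add (pairing_integrable hpq hDum hDu a b c)
        (pairing_integrable hpq hDum hDu s3' s2 s1), e1, add_zero] at e2
      exact e2
    · exact hne φ a b c h0

lemma conj_pq {p q : ℝ} (hq : 2 ≤ q) (hp : p = q / (q - 1)) : p.HolderConjugate q := by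
  have h := Real.HolderConjugate.conjExponent (p := q) (by linarith)
  have e : p = q.conjExponent := by rw [hp]; rfl
  rw [e]; exact h.symm

lemma aesm_loc {n : ℕ} {W : Type*} [NormedAddCommGroup W] {q : ℝ}
    {Ω : Set (EuclideanSpace ℝ (Fin n))} (hΩ : IsOpen Ω)
    {g : EuclideanSpace ℝ (Fin n) → W}
    (h : ∀ K, IsCompact K → K ⊆ Ω → MemLp g (ENNReal.ofReal q) (volume.restrict K)) :
    AEStronglyMeasurable g (volume.restrict Ω) := by
  refine aesm_of_local fun x hx => ?_
  obtain ⟨ε, hε, hb⟩ := Metric.isOpen_iff.1 hΩ x hx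
  refine ⟨ε / 2, by positivity, ?_⟩
  exact (h (closedBall x (ε / 2)) (isCompact_closedBall _ _)
    ((closedBall_subset_ball (by linarith)).trans hb)).1.mono_measure
    (Measure.restrict_mono ball_subset_closedBall le_rfl)

theorem final_thm (n : ℕ) (hn : 2 ≤ n) (q p α : ℝ) (hq : 2 ≤ q)
    (hp : p = q / (q - 1)) (hα1 : 0 < α) (hα2 : α < 1)
    (Ω : Set (EuclideanSpace ℝ (Fin n))) (hΩo : IsOpen Ω)
    (u f : EuclideanSpace ℝ (Fin n) → ℝ)
    (Du : EuclideanSpace ℝ (Fin n) → EuclideanSpace ℝ (Fin n))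
    (hu : MemW1Loc n q Ω u Du)
    (hf : MemBesovLoc n p α Ω f)
    (hsol : IsLocalWeakSolution n q Ω Du f) :
    (∀ r : ℝ, 1 ≤ r → r < 2 * (n : ℝ) / ((n : ℝ) - α - 1) →
      ∀ K : Set (EuclideanSpace ℝ (Fin n)), IsCompact K → K ⊆ Ω →
        IntegrableOn (fun x => ‖Hmap n (q / 2) (Du x)‖ ^ r) K volume) ∧
    (∀ s : ℝ, 1 ≤ s → s < (n : ℝ) * q / ((n : ℝ) - α - 1) →
      ∀ K : Set (EuclideanSpace ℝ (Fin n)), IsCompact K → K ⊆ Ω →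
        IntegrableOn (fun x => ‖Du x‖ ^ s) K volume) := by
  have hpq := conj_pq hq hp
  have hua := aesm_loc hΩo fun K a b => (hu.1 K a b).1
  have hDa := aesm_loc hΩo fun K a b => (hu.1 K a b).2
  obtain ⟨v, hvm', hv⟩ := hua
  obtain ⟨D, hDm', hD⟩ := hDa
  have hvm := hvm'.measurable
  have hDm := hDm'.measurable
  have hu' : MemW1Loc n q Ω v D := by
    refine ⟨fun K a b => ⟨?_, ?_⟩, fun φ a b c => ?_⟩
    · exact (hu.1 K a b).1.ae_eq (ae_restrict_of_ae_restrict_of_subset b hv)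
    · exact (hu.1 K a b).2.ae_eq (ae_restrict_of_ae_restrict_of_subset b hD)
    · have e1 : ∫ x in Ω, v x • gradient φ x = ∫ x in Ω, u x • gradient φ x := by
        refine integral_congr_ae ?_
        filter_upwards [hv] with x hx
        rw [hx]
      have e2 : ∫ x in Ω, φ x • D x = ∫ x in Ω, φ x • Du x := by
        refine integral_congr_ae ?_
        filter_upwards [hD] with x hx
        rw [hx]
      rw [e1, e2]
      exact hu.2 φ a b c
  have hsol' : IsLocalWeakSolution n q Ω D f := by
    intro φ a b c
    rw [← hsol φ a b c]
    refine integral_congr_ae ?_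
    filter_upwards [hD] with x hx
    rw [hx]
  obtain ⟨g, hgm, hgs, hg1, hg2⟩ := get_f hpq hΩo hDm (fun K a b => (hu'.1 K a b).2) hf hsol'
  have hden : (0 : ℝ) < n - α - 1 := by
    have : (2 : ℝ) ≤ n := by exact_mod_cast hn
    linarith
  have hVm : Measurable (fun x => Hmap n (q / 2) (D x)) := (Hmap_measurable (q / 2)).comp hDm
  have key : ∀ r : ℝ, 0 < r → r < 2 * (n : ℝ) / ((n : ℝ) - α - 1) →
      ∀ K : Set (EuclideanSpace ℝ (Fin n)), IsCompact K → K ⊆ Ω →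
        IntegrableOn (fun x => ‖Hmap n (q / 2) (D x)‖ ^ r) K volume := by
    intro r hr hrr K hK hKΩ
    have h := core hn hpq hq hα1 hα2 hvm hDm hgm hu' hgs hΩo hg1 hg2 hr hrr K hK hKΩ
    refine ⟨(hVm.norm.pow_const r).aestronglyMeasurable, ?_⟩
    rw [hasFiniteIntegral_iff_ofReal (Filter.Eventually.of_forall fun y => by positivity)]
    simp_rw [enorm_rpow_eq _ hr.le] at h
    exact h
  constructor
  · intro r hr hrr K hK hKΩ
    refine (key r (by linarith) hrr K hK hKΩ).congr ?_
    filter_upwards [ae_restrict_of_ae_restrict_of_subset hKΩ hD] with x hx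
    rw [hx]
  · intro s hs hss K hK hKΩ
    have hr : 2 * s / q < 2 * (n : ℝ) / ((n : ℝ) - α - 1) := by
      rw [lt_div_iff₀ hden] at hss
      rw [div_lt_div_iff₀ (by linarith) hden]
      nlinarith
    have h1 := key (2 * s / q) (by positivity) hr K hK hKΩ
    have hfin : IsFiniteMeasure (volume.restrict K) := ⟨by
      rw [Measure.restrict_apply_univ]; exact hK.measure_lt_top⟩
    have h2 : IntegrableOn (fun x => ‖D x‖ ^ s) K volume := by
      refine Integrable.mono' (((integrable_const (1 : ℝ)).add h1).const_mul (2 ^ s))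
        (hDm.norm.pow_const s).aestronglyMeasurable (Filter.Eventually.of_forall fun x => ?_)
      rw [Real.norm_of_nonneg (by positivity)]
      simp only [Pi.add_apply]
      rw [Hmap_norm _ (by linarith), ← Real.rpow_mul (le_max_right _ _),
        show q / 2 * (2 * s / q) = s by field_simp]
      set t := max (‖D x‖ - 1) 0 with ht
      have ht0 : 0 ≤ t := le_max_right _ _
      have h3 : ‖D x‖ ≤ 1 + t := by have := le_max_left (‖D x‖ - 1) 0; linarith
      have h4 : ‖D x‖ ≤ 2 * max 1 t := by
        have := le_max_left 1 t
        have := le_max_right 1 t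
        linarith
      have h5 : (max 1 t) ^ s ≤ 1 + t ^ s := by
        rcases max_cases 1 t with ⟨h, _⟩ | ⟨h, _⟩
        · rw [h, Real.one_rpow]; have := Real.rpow_nonneg ht0 s; linarith
        · rw [h]; linarith
      calc ‖D x‖ ^ s ≤ (2 * max 1 t) ^ s := Real.rpow_le_rpow (norm_nonneg _) h4 (by linarith)
        _ = 2 ^ s * (max 1 t) ^ s := Real.mul_rpow (by norm_num) (by positivity)
        _ ≤ _ := mul_le_mul_of_nonneg_left h5 (by positivity)
    refine h2.congr ?_
    filter_upwards [ae_restrict_of_ae_restrict_of_subset hKΩ hD] with x hx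
    rw [hx]

/-- **Corollary (higher integrability, `q ≥ 2`).**  Let `n ≥ 2`, `q ≥ 2`, `p = q/(q−1)`,
`α ∈ (0,1)`, `Ω ⊂ ℝⁿ` bounded open, `f ∈ B^α_{p,∞,loc}(Ω)`, and let `u ∈ W^{1,q}_loc(Ω)`
be a local weak solution of `−div((|∇u|−1)_+^{q−1}∇u/|∇u|) = f`.  Then
`H_{q/2}(∇u) ∈ L^r_loc(Ω)` for all `r ∈ [1, 2n/(n−α−1))` and `∇u ∈ L^s_loc(Ω)` for all
`s ∈ [1, nq/(n−α−1))`. -/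
theorem stmt17 (n : ℕ) (hn : 2 ≤ n) (q p α : ℝ) (hq : 2 ≤ q)
    (hp : p = q / (q - 1)) (hα1 : 0 < α) (hα2 : α < 1)
    (Ω : Set (EuclideanSpace ℝ (Fin n))) (hΩo : IsOpen Ω) (hΩb : Bornology.IsBounded Ω)
    (u f : EuclideanSpace ℝ (Fin n) → ℝ)
    (Du : EuclideanSpace ℝ (Fin n) → EuclideanSpace ℝ (Fin n))
    (hu : MemW1Loc n q Ω u Du)
    (hf : MemBesovLoc n p α Ω f)
    (hsol : IsLocalWeakSolution n q Ω Du f) :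
    (∀ r : ℝ, 1 ≤ r → r < 2 * (n : ℝ) / ((n : ℝ) - α - 1) →
      ∀ K : Set (EuclideanSpace ℝ (Fin n)), IsCompact K → K ⊆ Ω →
        IntegrableOn (fun x => ‖Hmap n (q / 2) (Du x)‖ ^ r) K volume) ∧
    (∀ s : ℝ, 1 ≤ s → s < (n : ℝ) * q / ((n : ℝ) - α - 1) →
      ∀ K : Set (EuclideanSpace ℝ (Fin n)), IsCompact K → K ⊆ Ω →
        IntegrableOn (fun x => ‖Du x‖ ^ s) K volume) := by
  exact final_thm n hn q p α hq hp hα1 hα2 Ω hΩo u f Du hu hf hsol
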